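/- Let p and n be positive integers with 2p ≤ n, let s_1 ≥ ... ≥ s_p ≥ 0, and let λ_1 ≥ ... ≥ λ_n be real numbers. Then the following are equivalent: (a) there exists an n×n complex Hermitian matrix of block form [[P, X],[X*, Q]] with P of size p×p, with eigenvalues λ_1, ..., λ_n, such that the p×(n−p) block X has singular values s_1, ..., s_p; (b) there exist p×p complex Hermitian matrices A, B, and C with eigenvalues λ_1, ..., λ_p (of A), λ_{n+1−p}, ..., λ_n (of B), and s_1, ..., s_p (of C), such that 2C ≤ A − B. -/

import Mathlib

open scoped ComplexOrder

/-- `M` is a Hermitian matrix whose eigenvalues, with multiplicity, are `{μ i : i}`. -/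
def HasEigs {ι : Type} [Fintype ι] [DecidableEq ι] (M : Matrix ι ι ℂ) (μ : ι → ℝ) : Prop :=
  ∃ U : Matrix ι ι ℂ, U * U.conjTranspose = 1 ∧ U.conjTranspose * U = 1 ∧
    M = U * Matrix.diagonal (fun i => (μ i : ℂ)) * U.conjTranspose

/-- `X` has singular values `s 1 ≥ s 2 ≥ ... ≥ s q ≥ 0` where `q = min(#rows, #cols)`:
`s` is weakly decreasing and nonnegative on `1..q`, and the eigenvalues of `Xᴴ * X`
are `s 1 ^ 2, ..., s q ^ 2` together with `#cols - q` zeros. -/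
def HasSVals {ι κ : Type} [Fintype ι] [Fintype κ] [DecidableEq κ]
    (X : Matrix ι κ ℂ) (q : ℕ) (s : ℕ → ℝ) : Prop :=
  q = min (Fintype.card ι) (Fintype.card κ) ∧
  (∀ a b, 1 ≤ a → a ≤ b → b ≤ q → s b ≤ s a) ∧
  (∀ a, 1 ≤ a → a ≤ q → 0 ≤ s a) ∧
  ∃ e : κ ≃ Fin (Fintype.card κ),
    HasEigs (X.conjTranspose * X)
      (fun j => if (e j : ℕ) + 1 ≤ q then s ((e j : ℕ) + 1) ^ 2 else 0)

open scoped Topology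

set_option linter.unusedSectionVars false
set_option linter.unusedSimpArgs false

/-- Separation of an open convex cone from an affine subspace that it does not meet. -/
theorem exists_functional_of_disjoint_cone {E : Type*} [TopologicalSpace E] [AddCommGroup E]
    [IsTopologicalAddGroup E] [Module ℝ E] [ContinuousSMul ℝ E] {C : Set E} (hopen : IsOpen C)
    (hconv : Convex ℝ C) (hne : C.Nonempty) (hcone : ∀ x ∈ C, ∀ r : ℝ, 0 < r → r • x ∈ C)
    (V : Submodule ℝ E) (e : E) (h : ∀ v ∈ V, v + e ∉ C) :
    ∃ f : E →L[ℝ] ℝ, f ≠ 0 ∧ (∀ x ∈ C, f x ≤ 0) ∧ (∀ v ∈ V, f v = 0) ∧ 0 ≤ f e := by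
  obtain ⟨f, u, hfC, hfV⟩ := geometric_hahn_banach_open hconv hopen
    (t := (fun v => v + e) '' (V : Set E)) (by
      have := V.convex.translate e
      simpa [add_comm] using this)
    (by
      rw [Set.disjoint_left]
      rintro _ hx ⟨v, hv, rfl⟩
      exact h v hv hx)
  have hV : ∀ v ∈ V, u ≤ f v + f e := fun v hv => by
    simpa using hfV _ ⟨v, hv, rfl⟩
  have hpos : ∀ x ∈ C, f x ≤ 0 := by
    intro x hx
    by_contra! hfx
    have := hfC _ (hcone x hx ((|u| + 1) / f x) (by positivity))
    rw [map_smul, smul_eq_mul, div_mul_cancel₀ _ hfx.ne'] at this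
    linarith [le_abs_self u]
  obtain ⟨x₀, hx₀⟩ := hne
  have hu : 0 ≤ u := by
    by_contra! hu
    have h1 := hfC _ hx₀
    have h2 : f x₀ < 0 := h1.trans hu
    have := hfC _ (hcone x₀ hx₀ (u / f x₀) (div_pos_of_neg_of_neg hu h2))
    rw [map_smul, smul_eq_mul, div_mul_cancel₀ _ h2.ne] at this
    exact lt_irrefl _ this
  have he : u ≤ f e := by simpa using hV 0 V.zero_mem
  refine ⟨f, ?_, hpos, ?_, hu.trans he⟩
  · rintro rfl
    have := hfC _ hx₀
    simp at this he
    linarith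
  · intro v hv
    by_contra hne
    have := hV _ (V.smul_mem ((u - f e - 1) / f v) hv)
    rw [map_smul, smul_eq_mul, div_mul_cancel₀ _ hne] at this
    linarith

namespace Matrix

variable {ι κ : Type} [Fintype ι] [DecidableEq ι] [Fintype κ] [DecidableEq κ]

theorem isUnit_one_sub_of_skew {x : Matrix ι ι ℂ} (hx : xᴴ = -x) : IsUnit (1 - x) := by
  have h : ((1 - x)ᴴ * (1 - x)).PosDef := by
    have : (1 - x)ᴴ * (1 - x) = 1 + xᴴ * x := by
      simp only [conjTranspose_sub, conjTranspose_one, hx]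
      noncomm_ring
    rw [this]
    exact PosDef.one.add_posSemidef (posSemidef_conjTranspose_mul_self x)
  exact isUnit_of_mul_isUnit_right h.isUnit

/-- A curve of unitary matrices, built by the Cayley transform, along which the second-order
expansion of the conjugates of `M` is prescribed by two skew-Hermitian matrices. -/
theorem exists_unitary_curve (M K L : Matrix ι ι ℂ) (hK : Kᴴ = -K) (hL : Lᴴ = -L) :
    ∃ W F : ℝ → Matrix ι ι ℂ, (∀ τ, W τ * (W τ)ᴴ = 1) ∧ Continuous F ∧
      F 0 = (L * M - M * L) + (1 / 2 : ℂ) • (K * (K * M - M * K) - (K * M - M * K) * K) ∧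
      ∀ τ : ℝ, W τ * M * (W τ)ᴴ = M + (τ : ℂ) • (K * M - M * K) + ((τ : ℂ) ^ 2) • F τ := by
  set k : ℝ → Matrix ι ι ℂ := fun τ => K + (τ : ℂ) • L with hk
  have kskew : ∀ τ, (k τ)ᴴ = -(k τ) := by
    intro τ
    simp [hk, conjTranspose_add, conjTranspose_smul, hK, hL, add_comm]
  set x : ℝ → Matrix ι ι ℂ := fun τ => ((τ : ℂ) / 2) • k τ with hx
  have xskew : ∀ τ, (x τ)ᴴ = -(x τ) := by
    intro τ
    simp [hx, conjTranspose_smul, kskew]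
  have hu : ∀ τ, IsUnit (1 - x τ) := fun τ => isUnit_one_sub_of_skew (xskew τ)
  have hdet : ∀ τ, IsUnit (1 - x τ).det := fun τ => (isUnit_iff_isUnit_det _).1 (hu τ)
  set V : ℝ → Matrix ι ι ℂ := fun τ => (1 - x τ)⁻¹ with hV
  have hV1 : ∀ τ, (1 - x τ) * V τ = 1 := fun τ => mul_nonsing_inv _ (hdet τ)
  have hV2 : ∀ τ, V τ * (1 - x τ) = 1 := fun τ => nonsing_inv_mul _ (hdet τ)
  have hkc : Continuous k := by fun_prop
  have hxc : Continuous x := by fun_prop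
  have hVc : Continuous V := by
    have : V = fun τ => ((1 - x τ).det)⁻¹ • (1 - x τ).adjugate := by
      funext τ
      simp [hV, inv_def, Ring.inverse_eq_inv']
    rw [this]
    have h1 : Continuous fun τ => 1 - x τ := continuous_const.sub hxc
    exact (h1.matrix_det.inv₀ fun τ => (hdet τ).ne_zero).smul h1.matrix_adjugate
  set G : ℝ → Matrix ι ι ℂ := fun τ =>
    L + (1 / 2 : ℂ) • (k τ * k τ) + ((τ : ℂ) / 4) • (k τ * k τ * k τ * V τ) with hG
  have hGc : Continuous G := by fun_prop
  have hW : ∀ τ, (1 + x τ) * V τ = 1 + (τ : ℂ) • K + ((τ : ℂ) ^ 2) • G τ := by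
    intro τ
    have e1 : 1 + (τ : ℂ) • K + ((τ : ℂ) ^ 2) • G τ =
        1 + (2 : ℂ) • x τ + (2 : ℂ) • (x τ * x τ) + (2 : ℂ) • (x τ * x τ * x τ * V τ) := by
      have e0 : (τ : ℂ) • k τ = (τ : ℂ) • K + ((τ : ℂ) ^ 2) • L := by
        simp only [hk, smul_add, smul_smul, sq]
      have e0' : (τ : ℂ) • K = (τ : ℂ) • k τ - ((τ : ℂ) ^ 2) • L := by rw [e0]; abel
      rw [e0']
      simp only [hG, hx, smul_add, smul_smul, smul_mul_assoc, mul_smul_comm]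
      match_scalars <;> ring
    have e2 : (1 + (2 : ℂ) • x τ + (2 : ℂ) • (x τ * x τ)) * (1 - x τ) +
        (2 : ℂ) • (x τ * x τ * x τ) = 1 + x τ := by
      simp only [two_smul]; noncomm_ring
    have e3 : (1 + (2 : ℂ) • x τ + (2 : ℂ) • (x τ * x τ)) =
        (1 + (2 : ℂ) • x τ + (2 : ℂ) • (x τ * x τ)) * (1 - x τ) * V τ := by
      rw [mul_assoc, hV1, mul_one]
    rw [e1, e3, ← smul_mul_assoc (2 : ℂ) (x τ * x τ * x τ), ← add_mul, e2]
  have hVH : ∀ τ, (V τ)ᴴ * (1 + x τ) = 1 := by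
    intro τ
    have := congrArg conjTranspose (hV1 τ)
    simpa [conjTranspose_mul, xskew] using this
  have hcomm : ∀ τ, (1 + x τ) * V τ = V τ * (1 + x τ) := by
    intro τ
    calc (1 + x τ) * V τ = V τ * ((1 - x τ) * (1 + x τ)) * V τ := by
          rw [← mul_assoc (V τ), hV2, one_mul]
      _ = V τ * (1 + x τ) * ((1 - x τ) * V τ) := by noncomm_ring
      _ = _ := by rw [hV1, mul_one]
  refine ⟨fun τ => 1 + (τ : ℂ) • K + ((τ : ℂ) ^ 2) • G τ,
    fun τ => G τ * M + M * (G τ)ᴴ - K * M * K + (τ : ℂ) • (K * M * (G τ)ᴴ - G τ * M * K)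
      + ((τ : ℂ) ^ 2) • (G τ * M * (G τ)ᴴ), ?_, ?_, ?_, ?_⟩
  · intro τ
    have h1 : (1 + x τ) * V τ * ((1 + x τ) * V τ)ᴴ = 1 := by
      have h2 : (1 + x τ)ᴴ = 1 - x τ := by simp [xskew, sub_eq_add_neg]
      have h3 : (1 - x τ) * (1 + x τ) = (1 + x τ) * (1 - x τ) := by noncomm_ring
      have h4 : (V τ) ᴴ = (1 + x τ)⁻¹ := by
        refine (inv_eq_left_inv (hVH τ)).symm
      have h5 : (1 + x τ) * (V τ)ᴴ = 1 := by
        rw [h4]; apply mul_nonsing_inv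
        exact (isUnit_iff_isUnit_det _).1 (by simpa using isUnit_one_sub_of_skew (x := - x τ) (by simp [xskew]))
      rw [conjTranspose_mul, h2, hcomm]
      calc V τ * (1 + x τ) * ((V τ)ᴴ * (1 - x τ)) = V τ * ((1 + x τ) * (V τ)ᴴ) * (1 - x τ) := by
            noncomm_ring
        _ = 1 := by rw [h5, mul_one, hV2]
    simp only [← hW]
    exact h1
  · have : Continuous fun τ => (G τ)ᴴ := hGc.matrix_conjTranspose
    fun_prop
  · have h0 : G 0 = L + (1 / 2 : ℂ) • (K * K) := by simp [hG, hk]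
    simp only [h0, conjTranspose_add, conjTranspose_smul, conjTranspose_mul, hK, hL]
    simp only [Complex.ofReal_zero, zero_smul, add_zero, mul_sub, sub_mul, add_mul, mul_add, smul_sub,
      smul_mul_assoc, mul_smul_comm, neg_mul, mul_neg, neg_neg, zero_pow two_ne_zero, ← mul_assoc]
    have : star (1 / 2 : ℂ) = 1 / 2 := by simp
    rw [this]
    match_scalars <;> ring
  · intro τ
    have h1 : (1 + (τ : ℂ) • K + ((τ : ℂ) ^ 2) • G τ)ᴴ =
        1 - (τ : ℂ) • K + ((τ : ℂ) ^ 2) • (G τ)ᴴ := by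
      simp [conjTranspose_add, conjTranspose_smul, hK, sub_eq_add_neg]
    simp only [h1]
    simp only [mul_sub, add_mul, mul_add, smul_sub, smul_add, one_mul, mul_one,
      smul_mul_assoc, mul_smul_comm, smul_smul]
    match_scalars <;> ring

theorem HasEigs.isHermitian {M : Matrix ι ι ℂ} {μ : ι → ℝ} (h : HasEigs M μ) :
    M.IsHermitian := by
  obtain ⟨U, -, -, rfl⟩ := h
  simp [IsHermitian, conjTranspose_mul, diagonal_conjTranspose, Matrix.mul_assoc, Pi.star_def]

theorem HasEigs.comp_equiv {M : Matrix ι ι ℂ} {μ : ι → ℝ} (h : HasEigs M μ) (σ : κ ≃ ι) :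
    ∃ U : Matrix ι κ ℂ, U * Uᴴ = 1 ∧ Uᴴ * U = 1 ∧
      M = U * diagonal (fun k => (μ (σ k) : ℂ)) * Uᴴ := by
  obtain ⟨U, h1, h2, h3⟩ := h
  refine ⟨U.submatrix id σ, ?_, ?_, ?_⟩
  · rw [conjTranspose_submatrix, submatrix_mul_equiv, h1, submatrix_id_id]
  · have := congrArg (fun Z => submatrix Z σ σ) h2
    simp only [submatrix_one_equiv] at this
    rw [conjTranspose_submatrix, ← this]
    exact (submatrix_mul _ _ _ _ _ Function.bijective_id).symm
  · have : diagonal (fun k => (μ (σ k) : ℂ)) =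
        (diagonal (fun i => (μ i : ℂ))).submatrix σ σ := by
      rw [submatrix_diagonal_equiv]; rfl
    rw [this, conjTranspose_submatrix, submatrix_mul_equiv, submatrix_mul_equiv, submatrix_id_id, h3]

theorem HasEigs.perm {M : Matrix ι ι ℂ} {μ : ι → ℝ} (h : HasEigs M μ) (σ : ι ≃ ι) :
    HasEigs M (μ ∘ σ) := HasEigs.comp_equiv h σ

theorem HasEigs.neg {M : Matrix ι ι ℂ} {μ : ι → ℝ} (h : HasEigs M μ) :
    HasEigs (-M) (fun i => -μ i) := by
  obtain ⟨U, h1, h2, h3⟩ := h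
  refine ⟨U, h1, h2, ?_⟩
  have : diagonal (fun i => ((-μ i : ℝ) : ℂ)) = - diagonal (fun i => (μ i : ℂ)) := by
    ext i j; by_cases h : i = j <;> simp [h]
  rw [this, h3, Matrix.mul_neg, Matrix.neg_mul]

theorem IsHermitian.exists_hasEigs_antitone {M : Matrix ι ι ℂ} (hM : M.IsHermitian)
    (e : ι ≃ Fin (Fintype.card ι)) :
    ∃ μ : Fin (Fintype.card ι) → ℝ, Antitone μ ∧ HasEigs M (μ ∘ e) := by
  refine ⟨hM.eigenvalues₀, hM.eigenvalues₀_antitone, ?_⟩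
  have h : HasEigs M hM.eigenvalues := by
    refine ⟨hM.eigenvectorUnitary, ?_, ?_, ?_⟩
    · exact Unitary.coe_mul_star_self _
    · exact Unitary.coe_star_mul_self _
    · have := hM.spectral_theorem
      rw [Unitary.conjStarAlgAut_apply] at this
      exact this
  have h2 := HasEigs.perm h (e.trans (Fintype.equivOfCardEq (Fintype.card_fin _)))
  convert h2 using 1
  funext i
  simp [IsHermitian.eigenvalues]

theorem re_star_dotProduct_self (x : ι → ℂ) : (star x ⬝ᵥ x).re = ∑ i, ‖x i‖ ^ 2 := by
  simp [dotProduct, ← Complex.normSq_eq_norm_sq, Complex.normSq_apply]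

theorem sum_norm_sq_pos {x : ι → ℂ} (hx : x ≠ 0) : 0 < ∑ i, ‖x i‖ ^ 2 := by
  obtain ⟨i, hi⟩ := Function.ne_iff.1 hx
  exact Finset.sum_pos' (fun _ _ => by positivity) ⟨i, Finset.mem_univ _, by
    have : 0 < ‖x i‖ := norm_pos_iff.2 hi
    positivity⟩

theorem re_star_dotProduct_diagonal (μ : ι → ℝ) (x : ι → ℂ) :
    (star x ⬝ᵥ (diagonal (fun i => (μ i : ℂ)) *ᵥ x)).re = ∑ i, μ i * ‖x i‖ ^ 2 := by
  simp only [dotProduct, mulVec_diagonal, Pi.star_apply, Complex.re_sum]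
  refine Finset.sum_congr rfl fun i _ => ?_
  rw [← Complex.normSq_eq_norm_sq, Complex.normSq_apply]
  simp
  ring

theorem star_mulVec_dotProduct_mulVec (V : Matrix ι κ ℂ) (hV : Vᴴ * V = 1) (x : κ → ℂ) :
    star (V *ᵥ x) ⬝ᵥ (V *ᵥ x) = star x ⬝ᵥ x := by
  rw [star_mulVec, dotProduct_mulVec, vecMul_vecMul, hV, vecMul_one]

/-- One half of the Courant–Fischer principle. -/
theorem HasEigs.le_of_compression {A : Matrix ι ι ℂ} {α : ι → ℝ} (hA : HasEigs A α)
    (V : Matrix ι κ ℂ) (hV : Vᴴ * V = 1) (c d : ℝ)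
    (hd : (Vᴴ * A * V - (d : ℂ) • 1).PosSemidef) (T : Finset ι)
    (hT : T.card < Fintype.card κ) (hc : ∀ i, i ∉ T → α i ≤ c) : d ≤ c := by
  obtain ⟨U, hU1, hU2, rfl⟩ := hA
  let f : (κ → ℂ) →ₗ[ℂ] (T → ℂ) :=
    (LinearMap.funLeft ℂ ℂ (fun i : T => (i : ι))).comp (Matrix.mulVecLin (Uᴴ * V))
  have hker : LinearMap.ker f ≠ ⊥ := by
    apply LinearMap.ker_ne_bot_of_finrank_lt
    simpa using hT
  obtain ⟨x, hx, hx0⟩ := (Submodule.ne_bot_iff _).1 hker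
  set w : ι → ℂ := (Uᴴ * V) *ᵥ x with hw
  have hwT : ∀ i ∈ T, w i = 0 := fun i hi => congrFun (LinearMap.mem_ker.1 hx) ⟨i, hi⟩
  have hwx : ∑ i, ‖w i‖ ^ 2 = ∑ i, ‖x i‖ ^ 2 := by
    rw [← re_star_dotProduct_self, ← re_star_dotProduct_self, hw, star_mulVec_dotProduct_mulVec]
    rw [conjTranspose_mul, conjTranspose_conjTranspose, Matrix.mul_assoc, ← Matrix.mul_assoc U, hU1, Matrix.one_mul, hV]
  have h1 : (star x ⬝ᵥ ((Vᴴ * (U * diagonal (fun i => (α i : ℂ)) * Uᴴ) * V) *ᵥ x)).re =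
      ∑ i, α i * ‖w i‖ ^ 2 := by
    rw [← re_star_dotProduct_diagonal, hw, star_mulVec]
    simp only [conjTranspose_mul, conjTranspose_conjTranspose, dotProduct_mulVec, vecMul_vecMul,
      Matrix.mul_assoc]
  have h2 := (Complex.le_def.1 (hd.dotProduct_mulVec_nonneg x)).1
  rw [sub_mulVec, dotProduct_sub, Complex.sub_re, h1, smul_mulVec, one_mulVec, dotProduct_smul,
    smul_eq_mul, Complex.re_ofReal_mul, re_star_dotProduct_self, ← hwx] at h2
  have h3 : ∑ i, α i * ‖w i‖ ^ 2 ≤ ∑ i, c * ‖w i‖ ^ 2 := by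
    refine Finset.sum_le_sum fun i _ => ?_
    by_cases hi : i ∈ T
    · simp [hwT i hi]
    · exact mul_le_mul_of_nonneg_right (hc i hi) (by positivity)
  rw [← Finset.mul_sum] at h3
  have h4 := sum_norm_sq_pos hx0
  rw [← hwx] at h4
  simp only [Complex.zero_re] at h2
  exact le_of_mul_le_mul_right (by linarith) h4

/-- Polar factorization of a matrix with orthogonal columns. -/
theorem exists_unitary_mul_diagonal (Y : Matrix ι ι ℂ) (t : ι → ℝ)
    (h : Yᴴ * Y = diagonal (fun i => ((t i ^ 2 : ℝ) : ℂ))) :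
    ∃ u : Matrix ι ι ℂ, u * uᴴ = 1 ∧ uᴴ * u = 1 ∧ Y = u * diagonal (fun i => (t i : ℂ)) := by
  have hent : ∀ i j, ∑ k, star (Y k i) * Y k j = if i = j then ((t i ^ 2 : ℝ) : ℂ) else 0 := by
    intro i j
    have := congrFun (congrFun h i) j
    rw [mul_apply] at this
    simpa [diagonal_apply] using this
  let v : ι → EuclideanSpace ℂ ι := fun j => WithLp.toLp 2 (fun k => ((t j : ℂ))⁻¹ * Y k j)
  have hv : Orthonormal ℂ (Set.domRestrict {j | t j ≠ 0} v) := by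
    rw [orthonormal_iff_ite]
    rintro ⟨i, hi⟩ ⟨j, hj⟩
    simp only [Set.mem_ofPred_eq] at hi hj
    have hi' : (t i : ℂ) ≠ 0 := by exact_mod_cast hi
    have h1 : inner ℂ (v i) (v j) = ((t i : ℂ))⁻¹ * ((t j : ℂ))⁻¹ * ∑ k, star (Y k i) * Y k j := by
      simp only [v, PiLp.inner_apply, RCLike.inner_apply, Finset.mul_sum]
      refine Finset.sum_congr rfl fun k _ => ?_
      simp
      ring
    simp only [Set.domRestrict_apply, h1, hent, Subtype.mk.injEq]
    by_cases hij : i = j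
    · subst hij
      simp only [if_true]
      push_cast
      field_simp
    · simp [hij]
  obtain ⟨b, hb⟩ := hv.exists_orthonormalBasis_extension_of_card_eq (by simp)
  let u : Matrix ι ι ℂ := fun i j => b j i
  have hu : uᴴ * u = 1 := by
    ext i j
    have := orthonormal_iff_ite.1 b.orthonormal i j
    simp only [PiLp.inner_apply, RCLike.inner_apply] at this
    rw [mul_apply, one_apply, ← this]
    refine Finset.sum_congr rfl fun k _ => ?_
    rw [conjTranspose_apply, mul_comm]
    rfl
  refine ⟨u, mul_eq_one_comm.1 hu, hu, ?_⟩
  ext i j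
  rw [mul_diagonal]
  by_cases hj : t j = 0
  · have h1 := hent j j
    simp only [hj, if_true] at h1
    have h2 : ∑ k, ‖Y k j‖ ^ 2 = 0 := by
      rw [← re_star_dotProduct_self (fun k => Y k j)]
      have : star (fun k => Y k j) ⬝ᵥ (fun k => Y k j) = ∑ k, star (Y k j) * Y k j := rfl
      rw [this, h1]; simp
    have h3 := (Finset.sum_eq_zero_iff_of_nonneg (fun k _ => by positivity)).1 h2 i (Finset.mem_univ _)
    simp [hj]
    simpa using h3
  · have h1 : b j = v j := hb j hj
    have hj' : (t j : ℂ) ≠ 0 := by exact_mod_cast hj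
    simp only [u, h1, v]
    field_simp

theorem exists_equiv_fin_antitone (s : ι → ℝ) :
    ∃ e : ι ≃ Fin (Fintype.card ι), ∀ i j, e i ≤ e j → s j ≤ s i := by
  let e0 := Fintype.equivFin ι
  let f : Fin (Fintype.card ι) → ℝ := fun k => - s (e0.symm k)
  refine ⟨e0.trans (Tuple.sort f).symm, fun i j hij => ?_⟩
  have := Tuple.monotone_sort f hij
  simp [f] at this
  exact this

/-- Fan–Hoffman: the singular values dominate the eigenvalues of a lower bound of the
Hermitian part. -/
theorem exists_svd_of_le_re (X : Matrix ι ι ℂ) (s : ι → ℝ) (hs : ∀ i, 0 ≤ s i)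
    (h : ((1 / 2 : ℂ) • (X + Xᴴ) - diagonal (fun i => (s i : ℂ))).PosSemidef) :
    ∃ (t : ι → ℝ) (u v : Matrix ι ι ℂ), (∀ i, s i ≤ t i) ∧ u * uᴴ = 1 ∧ uᴴ * u = 1 ∧
      v * vᴴ = 1 ∧ vᴴ * v = 1 ∧ X = u * diagonal (fun i => (t i : ℂ)) * vᴴ := by
  obtain ⟨e, he⟩ := exists_equiv_fin_antitone s
  have hpsd := posSemidef_conjTranspose_mul_self X
  obtain ⟨ω, hω, hE⟩ := hpsd.isHermitian.exists_hasEigs_antitone e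
  have hsω : ∀ i, s i ^ 2 ≤ ω (e i) := by
    intro i
    set c := s i
    let V : Matrix ι {j // e j ≤ e i} ℂ := fun a b => if a = b then 1 else 0
    have hV : V = (1 : Matrix ι ι ℂ).submatrix id Subtype.val := by
      ext a b; simp [V, one_apply]
    have hVV : Vᴴ * V = 1 := by
      ext a b
      simp [hV, mul_apply, one_apply, Subtype.ext_iff]
    refine HasEigs.le_of_compression hE V hVV _ _ ?_ (Finset.univ.filter fun j => e j < e i) ?_ ?_
    · have hcs : (diagonal (fun j : {j // e j ≤ e i} => ((2 * c * (s j - c) : ℝ) : ℂ))).PosSemidef := by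
        refine PosSemidef.diagonal fun j => ?_
        have h1 : c ≤ s j := he _ _ j.2
        have h2 : 0 ≤ 2 * c * (s j - c) :=
          mul_nonneg (mul_nonneg zero_le_two (hs i)) (sub_nonneg.2 h1)
        exact Complex.zero_le_real.2 h2
      have e1 := posSemidef_conjTranspose_mul_self ((X - (c : ℂ) • 1) * V)
      have e2 := (h.conjTranspose_mul_mul_same V).smul (a := ((2 * c : ℝ) : ℂ)) (by
        have : 0 ≤ 2 * c := mul_nonneg zero_le_two (hs i)
        exact_mod_cast this)
      have e3 : Vᴴ * diagonal (fun i => (s i : ℂ)) * V =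
          diagonal (fun j : {j // e j ≤ e i} => ((s j : ℝ) : ℂ)) := by
        have h5 : (diagonal (fun i => (s i : ℂ))) * V = V * diagonal (fun j : {j // e j ≤ e i} => ((s j : ℝ) : ℂ)) := by
          ext a b
          rw [diagonal_mul, mul_diagonal]
          by_cases hab : a = b
          · simp [hab, mul_comm]
          · simp [V, hab]
        rw [Matrix.mul_assoc, h5, ← Matrix.mul_assoc, hVV, Matrix.one_mul]
      have e4 : diagonal (fun j : {j // e j ≤ e i} => ((2 * c * (s j - c) : ℝ) : ℂ)) =
          ((2 * c : ℝ) : ℂ) • diagonal (fun j : {j // e j ≤ e i} => ((s j : ℝ) : ℂ)) -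
          ((2 * c ^ 2 : ℝ) : ℂ) • 1 := by
        ext a b
        by_cases hab : a = b
        · subst hab; simp; ring
        · simp [hab]
      have e5 := (e1.add e2).add hcs
      convert e5 using 1
      rw [Matrix.mul_sub Vᴴ, Matrix.sub_mul (Vᴴ * _), e3, e4]
      simp only [conjTranspose_mul, conjTranspose_sub, conjTranspose_smul, conjTranspose_one,
        Complex.star_def, Complex.conj_ofReal, Matrix.sub_mul, Matrix.mul_sub, Matrix.smul_mul, Matrix.mul_smul,
        Matrix.mul_add, Matrix.add_mul, Matrix.mul_one, Matrix.one_mul, ← Matrix.mul_assoc, smul_sub, smul_add, smul_smul, hVV]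
      push_cast
      match_scalars <;> ring
    · have h1 : Fintype.card {j // e j ≤ e i} = (Finset.univ.filter fun j => e j ≤ e i).card :=
        Fintype.card_subtype _
      rw [h1]
      apply Finset.card_lt_card
      rw [Finset.ssubset_iff_of_subset]
      · exact ⟨i, by simp, by simp⟩
      · intro j; simp only [Finset.mem_filter, Finset.mem_univ, true_and]; exact le_of_lt
    · intro j hj
      simp only [Finset.mem_filter, Finset.mem_univ, true_and, not_lt] at hj
      exact hω hj
  obtain ⟨V, hV1, hV2, hV3⟩ := hE
  have hω0 : ∀ i, 0 ≤ ω (e i) := fun i => (sq_nonneg _).trans (hsω i)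
  obtain ⟨u, hu1, hu2, hu3⟩ := exists_unitary_mul_diagonal (X * V) (fun i => √(ω (e i))) (by
      simp only [Real.sq_sqrt (hω0 _)]
      rw [conjTranspose_mul, Matrix.mul_assoc, ← Matrix.mul_assoc Xᴴ, hV3]
      simp only [← Matrix.mul_assoc]
      rw [hV2, Matrix.one_mul, Matrix.mul_assoc, hV2, Matrix.mul_one]
      rfl)
  refine ⟨_, u, V, fun i => Real.le_sqrt_of_sq_le (hsω i), hu1, hu2, hV1, hV2, ?_⟩
  rw [← hu3, Matrix.mul_assoc, hV1, Matrix.mul_one]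

/-- Cauchy interlacing, upper half, phrased as an operator bound for a compression. -/
theorem HasEigs.exists_ge_compression {M : Matrix ι ι ℂ} {α : ι → ℝ} (hM : HasEigs M α)
    (V : Matrix ι κ ℂ) (hV : Vᴴ * V = 1) (e : κ ≃ Fin (Fintype.card κ)) (a : κ → ℝ)
    (ha : ∀ k, (Finset.univ.filter fun i => a k < α i).card ≤ (e k : ℕ)) :
    ∃ A, HasEigs A a ∧ (A - Vᴴ * M * V).PosSemidef := by
  have hD : (Vᴴ * M * V).IsHermitian := by
    rw [IsHermitian, conjTranspose_mul, conjTranspose_mul, conjTranspose_conjTranspose,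
      (HasEigs.isHermitian hM).eq, Matrix.mul_assoc]
  obtain ⟨δ, hδ, hE⟩ := hD.exists_hasEigs_antitone e
  obtain ⟨U, hU1, hU2, hU3⟩ := hE
  have hle : ∀ k, δ (e k) ≤ a k := by
    intro k
    let f : {j // e j ≤ e k} → κ := Subtype.val
    have hf : Function.Injective f := Subtype.val_injective
    have hdiag : Uᴴ * (Vᴴ * M * V) * U = diagonal (fun i => (((δ ∘ e) i : ℝ) : ℂ)) := by
      rw [hU3]
      simp only [← Matrix.mul_assoc]
      rw [hU2, Matrix.one_mul, Matrix.mul_assoc, hU2, Matrix.mul_one]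
    have hsub : ∀ Z : Matrix ι ι ℂ, (V * U.submatrix id f)ᴴ * Z * (V * U.submatrix id f) =
        (Uᴴ * (Vᴴ * Z * V) * U).submatrix f f := by
      intro Z
      rw [submatrix_mul _ _ f id f Function.bijective_id,
        submatrix_mul _ _ f id id Function.bijective_id, conjTranspose_mul, conjTranspose_submatrix]
      simp only [Matrix.mul_assoc, submatrix_id_id]
    refine HasEigs.le_of_compression hM (V * U.submatrix id f) ?_ _ _ ?_
      (Finset.univ.filter fun i => a k < α i) ?_ ?_
    · have := hsub 1
      rw [Matrix.mul_one, Matrix.mul_one, hV, Matrix.mul_one, hU2, submatrix_one _ hf] at this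
      exact this
    · rw [hsub, hdiag]
      have : (diagonal (fun i => (((δ ∘ e) i : ℝ) : ℂ))).submatrix f f - ((δ (e k) : ℝ) : ℂ) • 1 =
          diagonal (fun j : {j // e j ≤ e k} => ((δ (e j) - δ (e k) : ℝ) : ℂ)) := by
        rw [submatrix_diagonal _ _ hf]
        ext i j
        by_cases h : i = j
        · subst h; simp [f]
        · simp [h]
      rw [this]
      refine PosSemidef.diagonal fun j => ?_
      exact Complex.zero_le_real.2 (sub_nonneg.2 (hδ j.2))
    · have h1 : Fintype.card {j // e j ≤ e k} = (e k : ℕ) + 1 := by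
        rw [Fintype.card_congr (e.subtypeEquiv (q := fun j => j ≤ e k) (fun _ => Iff.rfl))]
        rw [Fintype.card_subtype, Finset.filter_ge_eq_Iic, Fin.card_Iic]
      rw [h1]
      exact Nat.lt_succ_of_le (ha k)
    · intro i hi
      simpa using hi
  refine ⟨U * diagonal (fun i => (a i : ℂ)) * Uᴴ, ⟨U, hU1, hU2, rfl⟩, ?_⟩
  rw [hU3, ← Matrix.sub_mul, ← Matrix.mul_sub, diagonal_sub]
  refine PosSemidef.mul_mul_conjTranspose_same (PosSemidef.diagonal fun i => ?_) _
  have : (0 : ℝ) ≤ a i - δ (e i) := sub_nonneg.2 (hle i)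
  simpa using this

/-- The spectrum of a Hermitian block matrix constrains the singular values of its off-diagonal
block. -/
theorem exists_bounds_of_hasSVals (p n : ℕ) (hpn : 2 * p ≤ n) (lam s : ℕ → ℝ)
    (hlmono : ∀ a b, 1 ≤ a → a ≤ b → b ≤ n → lam b ≤ lam a)
    (P : Matrix (Fin p) (Fin p) ℂ) (X : Matrix (Fin p) (Fin (n - p)) ℂ)
    (Q : Matrix (Fin (n - p)) (Fin (n - p)) ℂ)
    (hM : HasEigs (fromBlocks P X Xᴴ Q) (fun i => lam ((finSumFinEquiv i : ℕ) + 1)))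
    (hX : HasSVals X p s) :
    ∃ A B C : Matrix (Fin p) (Fin p) ℂ,
        HasEigs A (fun i => lam ((i : ℕ) + 1)) ∧
        HasEigs B (fun i => lam (n - p + (i : ℕ) + 1)) ∧
        HasEigs C (fun i => s ((i : ℕ) + 1)) ∧
        (A - B - (C + C)).PosSemidef := by
  obtain ⟨-, -, -, e, W, hW1, hW2, hW3⟩ := hX
  have hlt : ∀ k : Fin p, (k : ℕ) < Fintype.card (Fin (n - p)) := by
    intro k; have := k.2; simp; omega
  let g : Fin p → Fin (n - p) := fun k => e.symm ⟨k, hlt k⟩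
  have hg : Function.Injective g := by
    intro a b hab
    have := e.symm.injective hab
    simpa [Fin.ext_iff] using this
  let J : Matrix (Fin (n - p)) (Fin p) ℂ := W.submatrix id g
  have hsub : ∀ Z : Matrix (Fin (n - p)) (Fin (n - p)) ℂ, Jᴴ * Z * J = (Wᴴ * Z * W).submatrix g g := by
    intro Z
    rw [submatrix_mul _ _ g id g Function.bijective_id,
        submatrix_mul _ _ g id id Function.bijective_id]
    simp [J]
  have hJ : Jᴴ * J = 1 := by
    have := hsub 1
    rwa [Matrix.mul_one, Matrix.mul_one, hW2, submatrix_one _ hg] at this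
  have hY : (X * J)ᴴ * (X * J) = diagonal (fun i : Fin p => ((s ((i : ℕ) + 1) ^ 2 : ℝ) : ℂ)) := by
    rw [conjTranspose_mul, Matrix.mul_assoc, ← Matrix.mul_assoc Xᴴ, ← Matrix.mul_assoc, hsub, hW3]
    have : Wᴴ * (W * diagonal (fun j => (((if (e j : ℕ) + 1 ≤ p then s ((e j : ℕ) + 1) ^ 2 else 0 : ℝ)) : ℂ)) * Wᴴ) * W
        = diagonal (fun j => (((if (e j : ℕ) + 1 ≤ p then s ((e j : ℕ) + 1) ^ 2 else 0 : ℝ)) : ℂ)) := by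
      simp only [← Matrix.mul_assoc]
      rw [hW2, Matrix.one_mul, Matrix.mul_assoc, hW2, Matrix.mul_one]
    rw [this, submatrix_diagonal _ _ hg]
    congr 1
    funext k
    have := k.2
    simp [g]
  obtain ⟨u, hu1, hu2, hu3⟩ := exists_unitary_mul_diagonal _ _ hY
  set S : Matrix (Fin p) (Fin p) ℂ := diagonal (fun i : Fin p => ((s ((i : ℕ) + 1) : ℝ) : ℂ)) with hS
  have hSH : Sᴴ = S := by
    rw [hS, diagonal_conjTranspose]; congr 1; funext i; simp
  have h1 : uᴴ * (X * J) = S := by rw [hu3, ← Matrix.mul_assoc, hu2, Matrix.one_mul]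
  have h2 : Jᴴ * (Xᴴ * u) = S := by
    rw [← hSH, ← h1]; simp [Matrix.mul_assoc]
  let c : ℂ := ((√2)⁻¹ : ℝ)
  have hc : c * c = 1 / 2 := by
    simp only [c]; rw [← Complex.ofReal_mul, ← mul_inv, Real.mul_self_sqrt (by norm_num)]; norm_num
  have hcc : star c = c := by simp [c]
  let V : ℂ → Matrix (Fin p ⊕ Fin (n - p)) (Fin p) ℂ := fun σ => fromRows (c • u) ((σ * c) • J)
  have hVH : ∀ σ : ℂ, star σ = σ → (V σ)ᴴ = fromCols (c • uᴴ) ((σ * c) • Jᴴ) := by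
    intro σ hσ
    simp only [V, conjTranspose_fromRows_eq_fromCols_conjTranspose, conjTranspose_smul, star_mul',
      hσ, hcc]
  have hVV : ∀ σ : ℂ, star σ = σ → σ * σ = 1 → (V σ)ᴴ * V σ = 1 := by
    intro σ hσ hσ2
    rw [hVH σ hσ, fromCols_mul_fromRows]
    simp only [Matrix.smul_mul, Matrix.mul_smul, hu2, hJ, smul_smul, ← add_smul]
    have : c * c + σ * c * (σ * c) = 1 := by linear_combination hc + c * c * hσ2 + hc
    rw [this, one_smul]
  have hVM : ∀ σ : ℂ, star σ = σ → σ * σ = 1 → (V σ)ᴴ * fromBlocks P X Xᴴ Q * V σ =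
      (1 / 2 : ℂ) • (uᴴ * (P * u) + Jᴴ * (Q * J)) + σ • S := by
    intro σ hσ hσ2
    rw [hVH σ hσ, Matrix.mul_assoc, fromBlocks_mul_fromRows, fromCols_mul_fromRows]
    simp only [Matrix.smul_mul, Matrix.mul_smul, Matrix.mul_add, smul_smul, smul_add, h1, h2]
    have e1 : σ * c * (σ * c) = 1 / 2 := by linear_combination hc + c * c * hσ2
    have e2 : c * (σ * c) = σ * (1 / 2) := by linear_combination σ * hc
    have e3 : σ * c * c = σ * (1 / 2) := by linear_combination σ * hc
    rw [e1, e2, e3, hc]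
    module
  have hcard : ∀ (m : ℕ) (T : Finset (Fin p ⊕ Fin (n - p))) (k : ℕ),
      (∀ i ∈ T, m ≤ (finSumFinEquiv i : ℕ) ∧ (finSumFinEquiv i : ℕ) < m + k) → T.card ≤ k := by
    intro m T k h
    have := Finset.card_le_card_of_injOn (s := T) (t := Finset.Ico m (m + k))
      (fun i => (finSumFinEquiv i : ℕ)) (fun i hi => by simpa using h i hi)
      (fun a _ b _ hab => finSumFinEquiv.injective (Fin.ext hab))
    simpa using this
  obtain ⟨A, hA, hA'⟩ := HasEigs.exists_ge_compression hM (V 1) (hVV 1 (by simp) (by simp))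
    (finCongr (Fintype.card_fin p).symm) (fun i => lam ((i : ℕ) + 1)) (fun k => by
      refine hcard 0 _ _ fun i hi => ?_
      simp only [Finset.mem_filter, Finset.mem_univ, true_and] at hi
      refine ⟨Nat.zero_le _, ?_⟩
      by_contra hcon
      simp at hcon
      exact absurd hi (not_lt.2 (hlmono _ _ (by omega) (by omega) (by have := (finSumFinEquiv i).2; omega))))
  obtain ⟨B, hB, hB'⟩ := HasEigs.exists_ge_compression (HasEigs.neg hM) (V (-1))
    (hVV (-1) (by simp) (by simp))
    ((Fin.revPerm).trans (finCongr (Fintype.card_fin p).symm)) (fun i => - lam (n - p + (i : ℕ) + 1)) (fun k => by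
      have hk := k.2
      refine hcard (n - p + k + 1) _ _ fun i hi => ?_
      simp only [Finset.mem_filter, Finset.mem_univ, true_and, neg_lt_neg_iff] at hi
      have hi2 := (finSumFinEquiv i).2
      constructor
      · by_contra hcon
        exact absurd hi (not_lt.2 (hlmono _ _ (by omega) (by omega) (by omega)))
      · simp [Fin.val_rev]; omega)
  refine ⟨A, -B, S, hA, by simpa using HasEigs.neg hB, ⟨1, by simp, by simp, by simp [hS]⟩, ?_⟩
  have := hA'.add hB'
  convert this using 1
  rw [hVM 1 (by simp) (by simp), Matrix.mul_neg, Matrix.neg_mul, hVM (-1) (by simp) (by simp)]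
  module

theorem re_trace_conjTranspose_diagonal_mul (α : ι → ℝ) (z : Matrix ι κ ℂ) :
    (trace (zᴴ * (diagonal (fun i => (α i : ℂ)) * z))).re = ∑ i, ∑ j, α i * ‖z i j‖ ^ 2 := by
  rw [trace, Complex.re_sum, Finset.sum_comm]
  refine Finset.sum_congr rfl fun j _ => ?_
  rw [diag_apply, mul_apply, Complex.re_sum]
  refine Finset.sum_congr rfl fun i _ => ?_
  rw [diagonal_mul, conjTranspose_apply, ← Complex.normSq_eq_norm_sq, Complex.normSq_apply]
  simp
  ring

theorem re_trace_mul_diagonal_conjTranspose (β : κ → ℝ) (z : Matrix ι κ ℂ) :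
    (trace (z * diagonal (fun i => (β i : ℂ)) * zᴴ)).re = ∑ i, ∑ j, β j * ‖z i j‖ ^ 2 := by
  rw [trace, Complex.re_sum]
  refine Finset.sum_congr rfl fun i _ => ?_
  rw [diag_apply, mul_apply, Complex.re_sum]
  refine Finset.sum_congr rfl fun j _ => ?_
  rw [mul_diagonal, conjTranspose_apply, ← Complex.normSq_eq_norm_sq, Complex.normSq_apply]
  simp
  ring

/-- The quadratic form of the Sylvester operator `y ↦ A y - y B` in eigencoordinates. -/
theorem re_trace_sylvester (U V z : Matrix ι ι ℂ) (α β : ι → ℝ) (hU : Uᴴ * U = 1)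
    (hV : Vᴴ * V = 1) :
    (trace ((U * z * Vᴴ)ᴴ * (U * diagonal (fun i => (α i : ℂ)) * Uᴴ) * (U * z * Vᴴ)) -
      trace ((U * z * Vᴴ) * (V * diagonal (fun i => (β i : ℂ)) * Vᴴ) * (U * z * Vᴴ)ᴴ)).re =
      ∑ i, ∑ j, (α i - β j) * ‖z i j‖ ^ 2 := by
  have h1 : trace ((U * z * Vᴴ)ᴴ * (U * diagonal (fun i => (α i : ℂ)) * Uᴴ) * (U * z * Vᴴ)) =
      trace (zᴴ * (diagonal (fun i => (α i : ℂ)) * z)) := by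
    have : (U * z * Vᴴ)ᴴ * (U * diagonal (fun i => (α i : ℂ)) * Uᴴ) * (U * z * Vᴴ) =
        V * (zᴴ * (Uᴴ * U) * diagonal (fun i => (α i : ℂ)) * (Uᴴ * U) * z * Vᴴ) := by
      simp only [conjTranspose_mul, conjTranspose_conjTranspose, Matrix.mul_assoc]
    rw [this, trace_mul_comm, Matrix.mul_assoc _ Vᴴ, hV, hU]
    simp only [Matrix.mul_one, Matrix.mul_assoc]
  have h2 : trace ((U * z * Vᴴ) * (V * diagonal (fun i => (β i : ℂ)) * Vᴴ) * (U * z * Vᴴ)ᴴ) =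
      trace (z * diagonal (fun i => (β i : ℂ)) * zᴴ) := by
    have : (U * z * Vᴴ) * (V * diagonal (fun i => (β i : ℂ)) * Vᴴ) * (U * z * Vᴴ)ᴴ =
        U * (z * (Vᴴ * V) * diagonal (fun i => (β i : ℂ)) * (Vᴴ * V) * zᴴ * Uᴴ) := by
      simp only [conjTranspose_mul, conjTranspose_conjTranspose, Matrix.mul_assoc]
    rw [this, trace_mul_comm, Matrix.mul_assoc _ Uᴴ, hV, hU]
    simp only [Matrix.mul_one, Matrix.mul_assoc]
  rw [h1, h2, Complex.sub_re, re_trace_conjTranspose_diagonal_mul,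
    re_trace_mul_diagonal_conjTranspose, ← Finset.sum_sub_distrib]
  refine Finset.sum_congr rfl fun i _ => ?_
  rw [← Finset.sum_sub_distrib]
  exact Finset.sum_congr rfl fun j _ => by ring

/-- Number of pairs `α i > β j` bounded below by testing on symmetric matrices. -/
theorem card_pairs_le (P : Matrix ι ι ℂ) (r α β : ι → ℝ) (e : ι ≃ Fin (Fintype.card ι))
    (hA : HasEigs (P + diagonal (fun i => (r i : ℂ))) α)
    (hB : HasEigs (P - diagonal (fun i => (r i : ℂ))) β) (hne : ∀ i j, α i ≠ β j) :
    Fintype.card {x : ι × ι // e x.1 ≤ e x.2 ∧ 0 ≤ r x.1 + r x.2} ≤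
      Fintype.card {x : ι × ι // β x.2 < α x.1} := by
  obtain ⟨U, hU1, hU2, hU3⟩ := hA
  obtain ⟨V, hV1, hV2, hV3⟩ := hB
  let ext : ({x : ι × ι // e x.1 ≤ e x.2 ∧ 0 ≤ r x.1 + r x.2} → ℂ) →ₗ[ℂ] Matrix ι ι ℂ :=
    { toFun := fun c => of fun i j => if h : 0 ≤ r i + r j then
        (if h' : e i ≤ e j then c ⟨(i, j), h', h⟩ else
          c ⟨(j, i), (not_le.1 h').le, by rw [add_comm]; exact h⟩) else 0
      map_add' := by
        intro c d; ext i j; simp only [of_apply, Matrix.add_apply]; split_ifs <;> simp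
      map_smul' := by
        intro c d; ext i j; simp only [of_apply, Matrix.smul_apply]; split_ifs <;> simp }
  have hext : ∀ c x, ext c x.1.1 x.1.2 = c x := by
    rintro c ⟨⟨i, j⟩, h, h'⟩
    simp only [ext, LinearMap.coe_mk, AddHom.coe_mk, of_apply]
    rw [dif_pos h', dif_pos h]
  have hsymm : ∀ c, (ext c)ᵀ = ext c := by
    intro c
    ext i j
    simp only [ext, LinearMap.coe_mk, AddHom.coe_mk, transpose_apply, of_apply]
    by_cases h : 0 ≤ r i + r j
    · have h0 : 0 ≤ r j + r i := by rwa [add_comm]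
      rw [dif_pos h, dif_pos h0]
      rcases lt_trichotomy (e i) (e j) with h1 | h1 | h1
      · rw [dif_neg (not_le.2 h1), dif_pos h1.le]
      · have : i = j := e.injective h1
        subst this
        rfl
      · rw [dif_neg (not_le.2 h1), dif_pos h1.le]
    · have h0 : ¬ 0 ≤ r j + r i := by rwa [add_comm]
      rw [dif_neg h, dif_neg h0]
  have hsupp : ∀ c i j, ¬ 0 ≤ r i + r j → ext c i j = 0 := by
    intro c i j h
    simp only [ext, LinearMap.coe_mk, AddHom.coe_mk, of_apply]
    rw [dif_neg h]
  let V' : Matrix ι ι ℂ := Vᴴᵀ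
  have hV'H : V'ᴴ = Vᵀ := by
    ext i j; simp [V']
  have hV'2 : V'ᴴ * V' = 1 := by
    rw [hV'H, ← transpose_mul, hV2, transpose_one]
  have hV'1 : V' * V'ᴴ = 1 := mul_eq_one_comm.1 hV'2
  have hBT : (P - diagonal (fun i => (r i : ℂ)))ᵀ = V' * diagonal (fun i => (β i : ℂ)) * V'ᴴ := by
    rw [hV3, transpose_mul, transpose_mul, hV'H, diagonal_transpose, Matrix.mul_assoc]
  let coords : Matrix ι ι ℂ →ₗ[ℂ] ({x : ι × ι // β x.2 < α x.1} → ℂ) :=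
    { toFun := fun y x => (Uᴴ * y * V') x.1.1 x.1.2
      map_add' := by intro y z; funext x; simp [Matrix.mul_add, Matrix.add_mul]
      map_smul' := by intro c y; funext x; simp }
  have hinj : Function.Injective (coords.comp ext) := by
    rw [← LinearMap.ker_eq_bot, LinearMap.ker_eq_bot']
    intro c hc
    set y := ext c with hy
    set z := Uᴴ * y * V' with hz
    have hyz : y = U * z * V'ᴴ := by
      rw [hz]
      simp only [Matrix.mul_assoc]
      rw [hV'1, Matrix.mul_one, ← Matrix.mul_assoc, hU1, Matrix.one_mul]
    have hzero : ∀ i j, β j < α i → z i j = 0 := fun i j h => congrFun hc ⟨(i, j), h⟩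
    have hq := re_trace_sylvester U V' z α β hU2 hV'2
    rw [← hyz, ← hU3, ← hBT] at hq
    have hq0 : 0 ≤ (trace (yᴴ * (P + diagonal (fun i => (r i : ℂ))) * y) -
        trace (y * (P - diagonal (fun i => (r i : ℂ)))ᵀ * yᴴ)).re := by
      have hyT : yᵀ = y := hsymm c
      have hyH : yᴴᵀ = yᴴ := by
        rw [← hyT]; ext i j; simp only [conjTranspose_apply, transpose_apply]
        rw [← congrFun (congrFun hyT i) j]; rfl
      have e1 : trace (y * Pᵀ * yᴴ) = trace (yᴴ * P * y) := by
        rw [← trace_transpose]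
        simp only [transpose_mul, transpose_transpose, hyT, hyH, Matrix.mul_assoc]
      have e2 : trace (yᴴ * (P + diagonal (fun i => (r i : ℂ))) * y) -
          trace (y * (P - diagonal (fun i => (r i : ℂ)))ᵀ * yᴴ) =
          trace (yᴴ * (diagonal (fun i => (r i : ℂ)) * y)) +
          trace (y * diagonal (fun i => (r i : ℂ)) * yᴴ) := by
        rw [transpose_sub, diagonal_transpose, Matrix.mul_add, Matrix.add_mul, trace_add,
          Matrix.mul_sub, Matrix.sub_mul, trace_sub, e1, Matrix.mul_assoc yᴴ (diagonal _)]
        ring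
      rw [e2, Complex.add_re, re_trace_conjTranspose_diagonal_mul,
        re_trace_mul_diagonal_conjTranspose, ← Finset.sum_add_distrib]
      refine Finset.sum_nonneg fun i _ => ?_
      rw [← Finset.sum_add_distrib]
      refine Finset.sum_nonneg fun j _ => ?_
      by_cases h : 0 ≤ r i + r j
      · rw [← add_mul]; positivity
      · simp [hy, hsupp c i j h]
    rw [hq] at hq0
    have hterm : ∀ i j, (α i - β j) * ‖z i j‖ ^ 2 ≤ 0 := by
      intro i j
      rcases lt_or_ge (β j) (α i) with h | h
      · simp [hzero i j h]
      · exact mul_nonpos_of_nonpos_of_nonneg (sub_nonpos.2 h) (by positivity)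
    have hz0 : z = 0 := by
      ext i j
      have h1 : ∑ i, ∑ j, (α i - β j) * ‖z i j‖ ^ 2 = 0 :=
        le_antisymm (Finset.sum_nonpos fun i _ => Finset.sum_nonpos fun j _ => hterm i j) hq0
      have h2 := (Finset.sum_eq_zero_iff_of_nonpos
        (fun i _ => Finset.sum_nonpos fun j _ => hterm i j)).1 h1 i (Finset.mem_univ _)
      have h3 := (Finset.sum_eq_zero_iff_of_nonpos (fun j _ => hterm i j)).1 h2 j (Finset.mem_univ _)
      have h4 : α i - β j ≠ 0 := sub_ne_zero.2 (hne i j)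
      simpa [h4] using h3
    have hy0 : y = 0 := by rw [hyz, hz0]; simp
    funext x
    rw [← hext c x, ← hy, hy0]
    rfl
  have := LinearMap.finrank_le_finrank_of_injective hinj
  simpa using this

theorem mulVec_col_of_eq_conj_diagonal {M U : Matrix ι ι ℂ} {μ : ι → ℂ} (hU2 : Uᴴ * U = 1)
    (hU3 : M = U * diagonal μ * Uᴴ) (i : ι) :
    M *ᵥ U.col i = μ i • U.col i := by
  have h : M * U = U * diagonal μ := by
    rw [hU3, Matrix.mul_assoc, hU2, Matrix.mul_one]
  ext k
  have := congrFun (congrFun h k) i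
  rw [mul_diagonal, mul_apply] at this
  simpa [mulVec, dotProduct, mul_comm] using this

theorem col_ne_zero_of_isometry {U : Matrix ι ι ℂ} (hU2 : Uᴴ * U = 1) (i : ι) : U.col i ≠ 0 := by
  intro h
  have h1 := congrFun (congrFun hU2 i) i
  rw [mul_apply, one_apply_eq] at h1
  have h2 : ∀ k, U k i = 0 := fun k => congrFun h k
  simp [h2] at h1

/-- If `P + diagonal r` and `P - diagonal r` share no eigenvalue and some `r i` is nonnegative, then
there is a skew-Hermitian/Hermitian pair satisfying the linearized constraint on which the quadratic
form defined by `r` is positive. -/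
theorem exists_skew_hermitian_pair (P : Matrix ι ι ℂ) (hP : P.IsHermitian) (r : ι → ℝ)
    (hr : ∃ i, 0 ≤ r i)
    (hno : ∀ (c : ℂ) (x y : ι → ℂ), (P + diagonal (fun i => (r i : ℂ))) *ᵥ x = c • x →
      (P - diagonal (fun i => (r i : ℂ))) *ᵥ y = c • y → x = 0 ∨ y = 0) :
    ∃ a b : Matrix ι ι ℂ, aᴴ = -a ∧ bᴴ = b ∧
      a * diagonal (fun i => (r i : ℂ)) + diagonal (fun i => (r i : ℂ)) * a +
        (b * P - P * b) = 0 ∧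
      0 < (trace ((a * a + b * b) * diagonal (fun i => (r i : ℂ)))).re := by
  set R : Matrix ι ι ℂ := diagonal (fun i => (r i : ℂ)) with hR
  have hRH : Rᴴ = R := by
    rw [hR, diagonal_conjTranspose]; congr 1; funext i; simp
  let e := Fintype.equivFin ι
  obtain ⟨α', -, hA⟩ := (IsHermitian.add hP hRH).exists_hasEigs_antitone e
  obtain ⟨β', -, hB⟩ := (IsHermitian.sub hP hRH).exists_hasEigs_antitone e
  set α := α' ∘ e
  set β := β' ∘ e
  have hA0 := hA
  have hB0 := hB
  obtain ⟨U, hU1, hU2, hU3⟩ := hA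
  obtain ⟨V, hV1, hV2, hV3⟩ := hB
  have hne : ∀ i j, α i ≠ β j := by
    intro i j h
    have h1 := mulVec_col_of_eq_conj_diagonal hU2 hU3 i
    have h2 := mulVec_col_of_eq_conj_diagonal hV2 hV3 j
    rw [← h] at h2
    rcases hno _ _ _ h1 h2 with h3 | h3
    · exact col_ne_zero_of_isometry hU2 i h3
    · exact col_ne_zero_of_isometry hV2 j h3
  have hcard := card_pairs_le P r α β e hA0 hB0 hne
  let skw : Matrix ι ι ℂ → Matrix ι ι ℂ := fun y => (1 / 2 : ℂ) • (yᴴ - y)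
  let hrm : Matrix ι ι ℂ → Matrix ι ι ℂ := fun y => (1 / 2 : ℂ) • (yᴴ + y)
  let defect : Matrix ι ι ℂ → Matrix ι ι ℂ := fun y =>
    skw y * R + R * skw y + (hrm y * P - P * hrm y)
  have hskw : ∀ y, (skw y)ᴴ = - skw y := by
    intro y; simp only [skw, conjTranspose_smul, conjTranspose_sub, conjTranspose_conjTranspose]
    simp [← smul_neg]
  have hhrm : ∀ y, (hrm y)ᴴ = hrm y := by
    intro y; simp only [hrm, conjTranspose_smul, conjTranspose_add, conjTranspose_conjTranspose]
    simp [add_comm]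
  have hsplit : ∀ y, y = hrm y - skw y := by
    intro y; simp only [skw, hrm]; module
  have hdefH : ∀ y, (defect y)ᴴ = - defect y := by
    intro y
    simp only [defect, conjTranspose_add, conjTranspose_sub, conjTranspose_mul, hskw, hhrm, hRH,
      hP.eq]
    noncomm_ring
  have hdadd : ∀ y z, defect (y + z) = defect y + defect z := by
    intro y z
    simp only [defect, skw, hrm, conjTranspose_add]
    simp only [Matrix.smul_mul, Matrix.mul_smul, ← smul_add, ← smul_sub]
    congr 1
    noncomm_ring
  have hdsmul : ∀ (t : ℝ) y, defect (t • y) = t • defect y := by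
    intro t y
    simp only [defect, skw, hrm, conjTranspose_smul, star_trivial]
    simp only [← smul_add, ← smul_sub, Matrix.smul_mul, Matrix.mul_smul, smul_comm (1 / 2 : ℂ) t]
  let emb : ({x : ι × ι // β x.2 < α x.1} → ℂ) → Matrix ι ι ℂ :=
    fun c => of fun i j => if h : β j < α i then c ⟨(i, j), h⟩ else 0
  let Φ : ({x : ι × ι // β x.2 < α x.1} → ℂ) →ₗ[ℝ]
      ({x : ι × ι // e x.1 < e x.2 ∧ 0 ≤ r x.1 + r x.2} → ℂ) × ({i // 0 ≤ r i} → ℝ) :=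
    { toFun := fun c => (fun x => defect (U * emb c * Vᴴ) x.1.1 x.1.2,
        fun i => (defect (U * emb c * Vᴴ) i i).im)
      map_add' := by
        intro c d
        have : emb (c + d) = emb c + emb d := by
          ext i j; simp only [emb, of_apply, Matrix.add_apply]; split_ifs <;> simp
        rw [this, Matrix.mul_add, Matrix.add_mul, hdadd]
        ext <;> simp
      map_smul' := by
        intro t d
        have : emb (t • d) = t • emb d := by
          ext i j; simp only [emb, of_apply, Matrix.smul_apply]; split_ifs <;> simp
        rw [this, Matrix.mul_smul, Matrix.smul_mul, hdsmul]
        ext <;> simp }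
  have hlt : Module.finrank ℝ (({x : ι × ι // e x.1 < e x.2 ∧ 0 ≤ r x.1 + r x.2} → ℂ) ×
      ({i // 0 ≤ r i} → ℝ)) < Module.finrank ℝ ({x : ι × ι // β x.2 < α x.1} → ℂ) := by
    have h1 : Fintype.card {x : ι × ι // e x.1 ≤ e x.2 ∧ 0 ≤ r x.1 + r x.2} =
        Fintype.card {x : ι × ι // e x.1 < e x.2 ∧ 0 ≤ r x.1 + r x.2} +
        Fintype.card {i // 0 ≤ r i} := by
      rw [← Fintype.card_sum]
      symm
      apply Fintype.card_of_bijective (f := Sum.elim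
        (fun x => (⟨x.1, x.2.1.le, x.2.2⟩ : {x : ι × ι // e x.1 ≤ e x.2 ∧ 0 ≤ r x.1 + r x.2}))
        (fun i => ⟨(i.1, i.1), le_rfl, add_nonneg i.2 i.2⟩))
      constructor
      · rintro (⟨⟨a, b⟩, h, h'⟩ | ⟨a, h⟩) (⟨⟨c, d⟩, k, k'⟩ | ⟨c, k⟩) hh <;>
          simp only [Sum.elim_inl, Sum.elim_inr, Subtype.mk.injEq, Prod.mk.injEq] at hh
        · obtain ⟨rfl, rfl⟩ := hh; rfl
        · obtain ⟨rfl, rfl⟩ := hh; exact absurd h (lt_irrefl _)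
        · obtain ⟨rfl, rfl⟩ := hh; exact absurd k (lt_irrefl _)
        · obtain ⟨rfl, -⟩ := hh; rfl
      · rintro ⟨⟨a, b⟩, h, h'⟩
        rcases lt_or_eq_of_le h with h1 | h1
        · exact ⟨Sum.inl ⟨(a, b), h1, h'⟩, rfl⟩
        · have hab : a = b := e.injective h1
          subst hab
          exact ⟨Sum.inr ⟨a, by simp at h'; linarith⟩, rfl⟩
    have h2 : 0 < Fintype.card {i // 0 ≤ r i} := by
      obtain ⟨i, hi⟩ := hr
      exact Fintype.card_pos_iff.2 ⟨⟨i, hi⟩⟩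
    rw [Module.finrank_prod, Module.finrank_pi_fintype, Module.finrank_pi_fintype,
      Module.finrank_pi_fintype]
    simp only [Complex.finrank_real_complex, Module.finrank_self, Finset.sum_const, Finset.card_univ, smul_eq_mul]
    omega
  obtain ⟨c, hcker, hc0⟩ := (Submodule.ne_bot_iff _).1 (LinearMap.ker_ne_bot_of_finrank_lt (f := Φ) hlt)
  set z := emb c with hz
  set y := U * z * Vᴴ with hy
  set a := skw y
  set b := hrm y
  set J := defect y with hJ
  have hker := LinearMap.mem_ker.1 hcker
  have hk1 : ∀ i j, e i < e j → 0 ≤ r i + r j → J i j = 0 := fun i j h h' =>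
    congrFun (congrArg Prod.fst hker) ⟨(i, j), h, h'⟩
  have hk2 : ∀ i, 0 ≤ r i → (J i i).im = 0 := fun i h =>
    congrFun (congrArg Prod.snd hker) ⟨i, h⟩
  have hJH : ∀ i j, star (J j i) = - J i j := fun i j =>
    congrFun (congrFun (hdefH y) i) j
  have hJ0 : ∀ i j, 0 ≤ r i + r j → J i j = 0 := by
    intro i j h
    rcases lt_trichotomy (e i) (e j) with h1 | h1 | h1
    · exact hk1 i j h1 h
    · have : i = j := e.injective h1
      subst this
      have h2 := congrArg Complex.re (hJH i i)
      simp at h2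
      exact Complex.ext (by simp; linarith) (hk2 i (by linarith))
    · have h2 := hk1 j i h1 (by linarith)
      have h3 := hJH i j
      rw [h2, star_zero] at h3
      simpa using h3.symm
  have hqpos : 0 < (trace (yᴴ * (P + R) * y) - trace (y * (P - R) * yᴴ)).re := by
    rw [hU3, hV3, hy, re_trace_sylvester U V z α β hU2 hV2]
    obtain ⟨⟨⟨i, j⟩, hij⟩, hx⟩ := Function.ne_iff.1 hc0
    have hzs : ∀ i j, 0 ≤ (α i - β j) * ‖z i j‖ ^ 2 := by
      intro i j
      by_cases h : β j < α i
      · exact mul_nonneg (sub_nonneg.2 h.le) (by positivity)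
      · simp [hz, emb, h]
    refine Finset.sum_pos' (fun i _ => Finset.sum_nonneg fun j _ => hzs i j)
      ⟨i, Finset.mem_univ _, Finset.sum_pos' (fun j _ => hzs i j) ⟨j, Finset.mem_univ _, ?_⟩⟩
    have h1 : z i j = c ⟨(i, j), hij⟩ := by
      simp only [hz, emb, of_apply]; rw [dif_pos hij]
    rw [h1]
    have : 0 < ‖c ⟨(i, j), hij⟩‖ := norm_pos_iff.2 hx
    have := sub_pos.2 hij
    simp only at this
    positivity
  let a₁ : Matrix ι ι ℂ := of fun i j => - J i j / ((r i + r j : ℝ) : ℂ)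
  have ha₁H : a₁ᴴ = - a₁ := by
    ext i j
    simp only [a₁, conjTranspose_apply, of_apply, star_div₀, star_neg, hJH, Matrix.neg_apply]
    simp [add_comm, neg_div]
  have ha₁ : a₁ * R + R * a₁ = - J := by
    ext i j
    rw [Matrix.add_apply, hR, mul_diagonal, diagonal_mul, Matrix.neg_apply]
    by_cases h : r i + r j = 0
    · simp [a₁, hJ0 i j h.ge]
    · have h' : (r i : ℂ) + r j ≠ 0 := by exact_mod_cast h
      simp only [a₁, of_apply]
      push_cast
      field_simp
      ring
  have htr1 : 0 ≤ (trace (a₁ * J)).re * (-1) := by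
    rw [trace, Complex.re_sum, Finset.sum_mul]
    refine Finset.sum_nonneg fun i _ => ?_
    rw [diag_apply, mul_apply, Complex.re_sum, Finset.sum_mul]
    refine Finset.sum_nonneg fun j _ => ?_
    have h1 : J j i = - star (J i j) := by rw [hJH, neg_neg]
    have h2 : a₁ i j * J j i = ((Complex.normSq (J i j) / (r i + r j) : ℝ) : ℂ) := by
      rw [h1]
      simp only [a₁, of_apply]
      push_cast
      rw [Complex.normSq_eq_conj_mul_self, Complex.star_def]
      ring
    rw [h2, Complex.ofReal_re]
    by_cases h : 0 ≤ r i + r j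
    · simp [hJ0 i j h]
    · rw [mul_neg_one, ← div_neg]
      exact div_nonneg (Complex.normSq_nonneg _) (by linarith)
  refine ⟨a + a₁, b, ?_, hhrm y, ?_, ?_⟩
  · rw [conjTranspose_add, hskw, ha₁H]; abel
  · have : (a + a₁) * R + R * (a + a₁) + (b * P - P * b) = J + (a₁ * R + R * a₁) := by
      rw [hJ]; simp only [defect]; noncomm_ring
    rw [this, ha₁, add_neg_cancel]
  · have hyH : yᴴ = b + a := by
      rw [hsplit y, conjTranspose_sub, hskw, hhrm]; abel
    have hyy : y = b - a := hsplit y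
    have e1 : trace (yᴴ * (P + R) * y) = trace ((b - a) * (b + a) * (P + R)) := by
      rw [trace_mul_comm, hyH, hyy, ← Matrix.mul_assoc]
    have e2 : trace (y * (P - R) * yᴴ) = trace ((b + a) * (b - a) * (P - R)) := by
      rw [trace_mul_comm, hyH, hyy, ← Matrix.mul_assoc]
    have e3 : trace (a * J) = trace (a * b * P) - trace (b * a * P) + 2 * trace (a * a * R) := by
      have : a * J = a * a * R + a * R * a + (a * b * P - a * P * b) := by
        rw [hJ]; simp only [defect]; noncomm_ring
      rw [this, trace_add, trace_add, trace_sub, trace_mul_comm (a * R) a, trace_mul_comm (a * P) b]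
      simp only [← Matrix.mul_assoc]
      ring
    have e4 : trace ((a + a₁) * (a + a₁) * R) = trace (a * a * R) - trace (a * J)
        - (1 / 2) * trace (a₁ * J) := by
      have h1 : trace (a * a₁ * R) + trace (a₁ * a * R) = - trace (a * J) := by
        rw [← trace_neg, ← Matrix.mul_neg, ← ha₁, Matrix.mul_add, trace_add,
          Matrix.mul_assoc a₁, trace_mul_comm a₁]
        simp only [← Matrix.mul_assoc]
      have h2 : trace (a₁ * a₁ * R) + trace (a₁ * a₁ * R) = - trace (a₁ * J) := by
        rw [← trace_neg, ← Matrix.mul_neg, ← ha₁, Matrix.mul_add, trace_add]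
        congr 1
        · simp only [← Matrix.mul_assoc]
        · rw [Matrix.mul_assoc a₁, trace_mul_comm a₁]
          simp only [← Matrix.mul_assoc]
      simp only [Matrix.add_mul, Matrix.mul_add, trace_add]
      linear_combination h1 + (1 / 2) * h2
    have e5 : trace (((a + a₁) * (a + a₁) + b * b) * R) =
        (1 / 2) * (trace (yᴴ * (P + R) * y) - trace (y * (P - R) * yᴴ))
          + (1 / 2) * (trace (a₁ * J) * (-1)) := by
      rw [Matrix.add_mul, trace_add, e4, e1, e2, e3]
      simp only [Matrix.add_mul, Matrix.mul_add, Matrix.sub_mul, Matrix.mul_sub, trace_add, trace_sub]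
      ring
    rw [e5, Complex.add_re]
    have hhalf : ∀ w : ℂ, ((1 / 2) * w).re = w.re / 2 := by intro w; simp; ring
    rw [hhalf, hhalf]
    have : (trace (a₁ * J) * (-1)).re = (trace (a₁ * J)).re * (-1) := by simp
    rw [this]
    linarith

/-- The Hermitian part of a square matrix. -/
noncomputable def hermPart (X : Matrix ι ι ℂ) : Matrix ι ι ℂ := (1 / 2 : ℂ) • (X + Xᴴ)

theorem hermPart_isHermitian (X : Matrix ι ι ℂ) : (hermPart X).IsHermitian := by
  simp only [IsHermitian, hermPart, conjTranspose_smul, conjTranspose_add,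
    conjTranspose_conjTranspose]
  simp [add_comm]

theorem hermPart_add (X Y : Matrix ι ι ℂ) : hermPart (X + Y) = hermPart X + hermPart Y := by
  simp only [hermPart, conjTranspose_add]; module

theorem hermPart_smul (c : ℝ) (X : Matrix ι ι ℂ) : hermPart (c • X) = c • hermPart X := by
  simp only [hermPart, conjTranspose_smul, star_trivial, ← smul_add, smul_comm (1 / 2 : ℂ) c]

theorem hermPart_of_isHermitian {X : Matrix ι ι ℂ} (h : Xᴴ = X) : hermPart X = X := by
  simp only [hermPart, h]; module

theorem hermPart_of_skew {X : Matrix ι ι ℂ} (h : Xᴴ = -X) : hermPart X = 0 := by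
  simp [hermPart, h]

theorem isHermitian_diagonal_ofReal (s : ι → ℝ) : (diagonal (fun i => (s i : ℂ)))ᴴ =
    diagonal (fun i => (s i : ℂ)) := by
  rw [diagonal_conjTranspose]; congr 1; funext i; simp

theorem posSemidef_diagonal_ofReal {s : ι → ℝ} (h : ∀ i, 0 ≤ s i) :
    (diagonal (fun i => (s i : ℂ))).PosSemidef :=
  PosSemidef.diagonal fun i => Complex.zero_le_real.2 (h i)

theorem PosSemidef.real_smul {X : Matrix ι ι ℂ} (h : X.PosSemidef) {c : ℝ} (hc : 0 ≤ c) :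
    (c • X).PosSemidef := by
  have := h.smul (a := (c : ℂ)) (Complex.zero_le_real.2 hc)
  simpa using this

theorem posSemidef_add_smul_one {H : Matrix ι ι ℂ} (hH : H.IsHermitian) {η : ℝ}
    (hη : ∑ i, ∑ j, ‖H i j‖ ≤ η) : (H + (η : ℂ) • 1).PosSemidef := by
  refine PosSemidef.of_dotProduct_mulVec_nonneg ?_ fun x => ?_
  · refine IsHermitian.add hH ?_
    simp [IsHermitian, conjTranspose_smul]
  have himH : (star x ⬝ᵥ (H *ᵥ x)).im = 0 := hH.im_star_dotProduct_mulVec_self x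
  have h1 : ‖star x ⬝ᵥ (H *ᵥ x)‖ ≤ η * ∑ k, ‖x k‖ ^ 2 := by
    have hS : ∀ i, ‖x i‖ ^ 2 ≤ ∑ k, ‖x k‖ ^ 2 := fun i =>
      Finset.single_le_sum (f := fun k => ‖x k‖ ^ 2) (fun _ _ => by positivity) (Finset.mem_univ i)
    calc ‖star x ⬝ᵥ (H *ᵥ x)‖ ≤ ∑ i, ∑ j, ‖H i j‖ * ∑ k, ‖x k‖ ^ 2 := by
          simp only [dotProduct, mulVec, Finset.mul_sum]
          refine (norm_sum_le _ _).trans (Finset.sum_le_sum fun i _ => ?_)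
          refine (norm_sum_le _ _).trans (Finset.sum_le_sum fun j _ => ?_)
          rw [← Finset.mul_sum, norm_mul, norm_mul, Pi.star_apply, norm_star]
          have : ‖x i‖ * ‖x j‖ ≤ ∑ k, ‖x k‖ ^ 2 := by
            nlinarith [hS i, hS j, sq_nonneg (‖x i‖ - ‖x j‖)]
          calc ‖x i‖ * (‖H i j‖ * ‖x j‖) = ‖H i j‖ * (‖x i‖ * ‖x j‖) := by ring
            _ ≤ _ := mul_le_mul_of_nonneg_left this (norm_nonneg _)
      _ = (∑ i, ∑ j, ‖H i j‖) * ∑ k, ‖x k‖ ^ 2 := by simp only [Finset.sum_mul]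
      _ ≤ _ := mul_le_mul_of_nonneg_right hη (Finset.sum_nonneg fun _ _ => by positivity)
  have h2 : star x ⬝ᵥ ((H + (η : ℂ) • 1) *ᵥ x) =
      star x ⬝ᵥ (H *ᵥ x) + (η : ℂ) * (star x ⬝ᵥ x) := by
    rw [add_mulVec, dotProduct_add, smul_mulVec, one_mulVec, dotProduct_smul, smul_eq_mul]
  have him : (star x ⬝ᵥ x).im = 0 := by
    have := (isHermitian_one (n := ι) (α := ℂ)).im_star_dotProduct_mulVec_self x
    simpa using this
  rw [h2, Complex.le_def]
  constructor
  · rw [Complex.add_re, Complex.re_ofReal_mul, re_star_dotProduct_self, Complex.zero_re]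
    have := (Complex.abs_re_le_norm _).trans h1
    have := (abs_le.1 this).1
    linarith
  · simp [himH, him]

/-- Sum of the squared moduli of the entries. -/
def frobSq (X : Matrix ι κ ℂ) : ℝ := ∑ i, ∑ j, Complex.normSq (X i j)

theorem frobSq_diagonal_add (t : ι → ℝ) (c : ℝ) (E : Matrix ι ι ℂ) :
    frobSq (diagonal (fun i => (t i : ℂ)) + c • E) =
      ∑ i, t i ^ 2 + c * (2 * ∑ i, t i * (E i i).re + c * frobSq E) := by
  have h : ∀ i j, Complex.normSq ((diagonal (fun i => (t i : ℂ)) + c • E) i j) =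
      (if i = j then t i ^ 2 else 0) + (if i = j then c * (2 * (t i * (E i i).re)) else 0) +
        c * (c * Complex.normSq (E i j)) := by
    intro i j
    by_cases hij : i = j
    · subst hij
      simp [Complex.normSq_apply]
      ring
    · simp [hij, Complex.normSq_apply]
      ring
  simp only [frobSq, h, Finset.sum_add_distrib, Finset.sum_ite_eq, Finset.mem_univ, if_true,
    Finset.mul_sum]
  simp only [mul_add, Finset.mul_sum]
  ring

/-- At a minimizer, no second-order variation improves both constraint and objective. -/
theorem no_descent (P Q : Matrix ι ι ℂ) (s t : ι → ℝ) (hst : ∀ i, s i ≤ t i)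
    (hmin : ∀ W : Matrix (ι ⊕ ι) (ι ⊕ ι) ℂ, W * Wᴴ = 1 →
      (hermPart (W * fromBlocks P (diagonal fun i => (t i : ℂ)) (diagonal fun i => (t i : ℂ)) Q
        * Wᴴ).toBlocks₁₂ - diagonal fun i => (s i : ℂ)).PosSemidef →
      ∑ i, t i ^ 2 ≤ frobSq (W * fromBlocks P (diagonal fun i => (t i : ℂ))
        (diagonal fun i => (t i : ℂ)) Q * Wᴴ).toBlocks₁₂)
    (M : Matrix (ι ⊕ ι) (ι ⊕ ι) ℂ)
    (hM : M = fromBlocks P (diagonal fun i => (t i : ℂ)) (diagonal fun i => (t i : ℂ)) Q)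
    (K L : Matrix (ι ⊕ ι) (ι ⊕ ι) ℂ) (hK : Kᴴ = -K) (hL : Lᴴ = -L)
    (hKM : (K * M - M * K).toBlocks₁₂ = 0) (E : Matrix ι ι ℂ)
    (hE : E = (L * M - M * L).toBlocks₁₂ +
      ((1 / 2 : ℂ) • (K * (K * M - M * K) - (K * M - M * K) * K)).toBlocks₁₂)
    (c η : ℝ) (hη : 0 < η)
    (hpsd : (hermPart E + c • diagonal (fun i => ((t i - s i : ℝ) : ℂ)) - η • 1).PosSemidef)
    (htr : ∑ i, t i * (E i i).re < 0) : False := by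
  obtain ⟨W, F, hW, hF, hF0, hWF⟩ := exists_unitary_curve M K L hK hL
  let G : ℝ → Matrix ι ι ℂ := fun τ => (F τ).toBlocks₁₂
  have hGij : ∀ i j, Continuous fun τ => G τ i j := fun i j =>
    (continuous_apply_apply (Sum.inl i) (Sum.inr j)).comp hF
  have hG0 : G 0 = E := by
    simp only [G, hF0, hE]; rfl
  have hblock : ∀ τ : ℝ, (W τ * M * (W τ)ᴴ).toBlocks₁₂ =
      diagonal (fun i => (t i : ℂ)) + (τ ^ 2) • G τ := by
    intro τ
    have h1 : (W τ * M * (W τ)ᴴ).toBlocks₁₂ =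
        M.toBlocks₁₂ + (τ : ℂ) • (K * M - M * K).toBlocks₁₂ + ((τ : ℂ) ^ 2) • (F τ).toBlocks₁₂ := by
      rw [hWF τ]; rfl
    rw [h1, hKM, smul_zero, add_zero, hM, toBlocks_fromBlocks₁₂, ← Complex.ofReal_pow,
      Complex.coe_smul]
  have c1 : Continuous fun τ => ∑ i, ∑ j, ‖hermPart (G τ - E) i j‖ := by
    simp only [hermPart, Matrix.smul_apply, Matrix.add_apply, conjTranspose_apply, Matrix.sub_apply]
    fun_prop
  have c2 : Continuous fun τ : ℝ => 2 * ∑ i, t i * (G τ i i).re + τ ^ 2 * frobSq (G τ) := by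
    simp only [frobSq]
    have := Complex.continuous_normSq
    fun_prop
  have ev1 : ∀ᶠ τ in 𝓝 (0 : ℝ), ∑ i, ∑ j, ‖hermPart (G τ - E) i j‖ < η := by
    refine c1.continuousAt.eventually_lt continuousAt_const ?_
    simp [hG0, hermPart, hη]
  have ev2 : ∀ᶠ τ in 𝓝 (0 : ℝ), 2 * ∑ i, t i * (G τ i i).re + τ ^ 2 * frobSq (G τ) < 0 := by
    refine c2.continuousAt.eventually_lt continuousAt_const ?_
    simp only [hG0]
    linarith
  have ev3 : ∀ᶠ τ in 𝓝 (0 : ℝ), τ ^ 2 * c < 1 := by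
    refine Continuous.continuousAt (by fun_prop) |>.eventually_lt continuousAt_const ?_
    simp
  obtain ⟨τ, ⟨⟨h1, h2⟩, h3⟩, h4⟩ :=
    ((((ev1.and ev2).and ev3).filter_mono nhdsWithin_le_nhds).and
      (self_mem_nhdsWithin (a := (0 : ℝ)) (s := {0}ᶜ))).exists
  have hτ : 0 < τ ^ 2 := by
    have : τ ≠ 0 := h4
    positivity
  have hle := hmin (W τ) (hW τ) (by
    rw [← hM, hblock τ]
    have p1 := posSemidef_add_smul_one (hermPart_isHermitian (G τ - E)) h1.le
    have p2 := ((p1.add hpsd).real_smul hτ.le).add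
      ((posSemidef_diagonal_ofReal (s := fun i => t i - s i)
        fun i => sub_nonneg.2 (hst i)).real_smul (sub_nonneg.2 h3.le))
    convert p2 using 1
    rw [hermPart_add, hermPart_smul, hermPart_of_isHermitian (isHermitian_diagonal_ofReal t)]
    have e1 : hermPart (G τ - E) = hermPart (G τ) - hermPart E := by
      simp only [hermPart, conjTranspose_sub]; module
    have e2 : diagonal (fun i => ((t i - s i : ℝ) : ℂ)) =
        diagonal (fun i => (t i : ℂ)) - diagonal (fun i => (s i : ℂ)) := by
      rw [diagonal_sub]; congr 1; funext i; simp
    have e3 : (η : ℂ) • (1 : Matrix ι ι ℂ) = η • 1 := by simp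
    rw [e1, e2, e3]
    module)
  rw [← hM, hblock τ, frobSq_diagonal_add] at hle
  nlinarith

/-- First-order directions which improve the objective `∑ i, t i ^ 2` and strictly respect the
constraint `diagonal s ≤ hermPart X` at `X = diagonal t`. -/
def descentCone (s t : ι → ℝ) : Set (Matrix ι ι ℂ) :=
  {E | ∃ c η : ℝ, 0 < η ∧
    (hermPart E + c • diagonal (fun i => ((t i - s i : ℝ) : ℂ)) - η • 1).PosSemidef ∧
    ∑ i, t i * (E i i).re < 0}

theorem isOpen_descentCone (s t : ι → ℝ) : IsOpen (descentCone s t) := by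
  rw [isOpen_iff_mem_nhds]
  rintro E ⟨c, η, hη, hpsd, htr⟩
  have c1 : Continuous fun F : Matrix ι ι ℂ => ∑ i, ∑ j, ‖hermPart (F - E) i j‖ := by
    simp only [hermPart, Matrix.smul_apply, Matrix.add_apply, conjTranspose_apply, Matrix.sub_apply]
    fun_prop
  have c2 : Continuous fun F : Matrix ι ι ℂ => ∑ i, t i * (F i i).re := by fun_prop
  have ev1 : ∀ᶠ F in 𝓝 E, ∑ i, ∑ j, ‖hermPart (F - E) i j‖ < η / 2 := by
    refine c1.continuousAt.eventually_lt continuousAt_const ?_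
    simp [hermPart, hη]
  have ev2 : ∀ᶠ F in 𝓝 E, ∑ i, t i * (F i i).re < 0 :=
    c2.continuousAt.eventually_lt continuousAt_const htr
  filter_upwards [ev1, ev2] with F h1 h2
  refine ⟨c, η / 2, by positivity, ?_, h2⟩
  have p := (posSemidef_add_smul_one (hermPart_isHermitian (F - E)) h1.le).add hpsd
  convert p using 1
  have e1 : hermPart (F - E) = hermPart F - hermPart E := by
    simp only [hermPart, conjTranspose_sub]; module
  rw [e1, Complex.coe_smul]
  module

theorem smul_mem_descentCone {s t : ι → ℝ} {E : Matrix ι ι ℂ} (hE : E ∈ descentCone s t) (r : ℝ)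
    (hr : 0 < r) : r • E ∈ descentCone s t := by
  obtain ⟨c, η, hη, hpsd, htr⟩ := hE
  refine ⟨r * c, r * η, by positivity, ?_, ?_⟩
  · convert hpsd.real_smul hr.le using 1
    rw [hermPart_smul]
    module
  · have : ∑ i, t i * ((r • E) i i).re = r * ∑ i, t i * (E i i).re := by
      rw [Finset.mul_sum]
      refine Finset.sum_congr rfl fun i _ => ?_
      simp
      ring
    rw [this]
    exact mul_neg_of_pos_of_neg hr htr

theorem add_mem_descentCone {s t : ι → ℝ} {E F : Matrix ι ι ℂ} (hE : E ∈ descentCone s t)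
    {c : ℝ} (hF : (hermPart F + c • diagonal (fun i => ((t i - s i : ℝ) : ℂ))).PosSemidef)
    (hF' : ∑ i, t i * (F i i).re ≤ 0) : F + E ∈ descentCone s t := by
  obtain ⟨c', η, hη, hpsd, htr⟩ := hE
  refine ⟨c + c', η, hη, ?_, ?_⟩
  · convert hF.add hpsd using 1
    rw [hermPart_add]
    module
  · simp only [add_apply, Complex.add_re, mul_add, Finset.sum_add_distrib]
    linarith

theorem convex_descentCone (s t : ι → ℝ) : Convex ℝ (descentCone s t) := by
  rw [convex_iff_forall_pos]
  intro E hE F hF a b ha hb _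
  obtain ⟨c, η, hη, hpsd, htr⟩ := smul_mem_descentCone hE a ha
  refine add_mem_descentCone (smul_mem_descentCone hF b hb) (c := c) ?_ htr.le
  have : (η • (1 : Matrix ι ι ℂ)).PosSemidef := PosSemidef.one.real_smul hη.le
  convert hpsd.add this using 1
  module

theorem nonempty_descentCone {s t : ι → ℝ} (hs : ∀ i, 0 ≤ s i) (hst : ∀ i, s i ≤ t i) {i₀ : ι}
    (hi₀ : s i₀ < t i₀) : (descentCone s t).Nonempty := by
  have ht0 : 0 < t i₀ := (hs i₀).trans_lt hi₀
  set c := (∑ i, t i + 1) / t i₀ with hc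
  have hsum : 0 ≤ ∑ i, t i := Finset.sum_nonneg fun i _ => (hs i).trans (hst i)
  have hc0 : 0 ≤ c := by positivity
  refine ⟨diagonal fun i => ((1 - if i = i₀ then c else 0 : ℝ) : ℂ), c / (t i₀ - s i₀), 1,
    one_pos, ?_, ?_⟩
  · have hd := sub_pos.2 hi₀
    rw [hermPart_of_isHermitian (isHermitian_diagonal_ofReal _)]
    have : (diagonal fun i => ((1 - if i = i₀ then c else 0 : ℝ) : ℂ)) +
        (c / (t i₀ - s i₀)) • diagonal (fun i => ((t i - s i : ℝ) : ℂ)) - (1 : ℝ) • 1 =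
        diagonal fun i => ((c / (t i₀ - s i₀) * (t i - s i) - if i = i₀ then c else 0 : ℝ) : ℂ) := by
      ext i j
      by_cases hij : i = j
      · subst hij; simp; ring
      · simp [hij]
    rw [this]
    refine posSemidef_diagonal_ofReal fun i => ?_
    split_ifs with h
    · subst h; rw [div_mul_cancel₀ _ hd.ne']; simp
    · have := sub_nonneg.2 (hst i)
      rw [sub_zero]; positivity
  · have : ∀ i, t i * ((diagonal fun i => ((1 - if i = i₀ then c else 0 : ℝ) : ℂ)) i i).re =
        t i - if i = i₀ then t i₀ * c else 0 := by
      intro i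
      rw [diagonal_apply_eq, Complex.ofReal_re]
      split_ifs with h
      · subst h; ring
      · ring
    simp only [this, Finset.sum_sub_distrib, Finset.sum_ite_eq', Finset.mem_univ, if_true]
    rw [hc, mul_div_cancel₀ _ ht0.ne']
    linarith

section Polar
variable {s t : ι → ℝ} {f : Matrix ι ι ℂ →L[ℝ] ℝ}

theorem polar_nonpos (hs : ∀ i, 0 ≤ s i) (hst : ∀ i, s i ≤ t i) {i₀ : ι} (hi₀ : s i₀ < t i₀)
    (hf : ∀ x ∈ descentCone s t, f x ≤ 0) {F : Matrix ι ι ℂ} (c : ℝ)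
    (hF : (hermPart F + c • diagonal (fun i => ((t i - s i : ℝ) : ℂ))).PosSemidef)
    (hF' : ∑ i, t i * (F i i).re ≤ 0) : f F ≤ 0 := by
  obtain ⟨E, hE⟩ := nonempty_descentCone hs hst hi₀
  refine le_of_forall_pos_le_add fun ε hε => ?_
  have hfE := hf E hE
  have := hf _ (add_mem_descentCone (smul_mem_descentCone hE (ε / (1 - f E))
    (div_pos hε (by linarith))) hF hF')
  rw [map_add, map_smul, smul_eq_mul] at this
  have h2 : ε / (1 - f E) * (1 - f E) = ε := div_mul_cancel₀ _ (by linarith)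
  have h3 : 0 < ε / (1 - f E) := div_pos hε (by linarith)
  nlinarith

theorem polar_skew (hs : ∀ i, 0 ≤ s i) (hst : ∀ i, s i ≤ t i) {i₀ : ι} (hi₀ : s i₀ < t i₀)
    (hf : ∀ x ∈ descentCone s t, f x ≤ 0) {F : Matrix ι ι ℂ} (hF : Fᴴ = -F) : f F = 0 := by
  have key : ∀ G : Matrix ι ι ℂ, Gᴴ = -G → f G ≤ 0 := by
    intro G hG
    refine polar_nonpos hs hst hi₀ hf 0 ?_ ?_
    · rw [hermPart_of_skew hG, zero_smul, add_zero]; exact PosSemidef.zero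
    · refine (Finset.sum_eq_zero fun i _ => ?_).le
      have := congrArg Complex.re (congrFun (congrFun hG i) i)
      simp only [conjTranspose_apply, neg_apply, Complex.neg_re, RCLike.star_def,
        Complex.conj_re] at this
      rw [show (G i i).re = 0 by linarith, mul_zero]
  have h1 := key F hF
  have h2 := key (-F) (by rw [conjTranspose_neg, hF])
  rw [map_neg] at h2
  linarith

theorem polar_single_swap (hs : ∀ i, 0 ≤ s i) (hst : ∀ i, s i ≤ t i) {i₀ : ι}
    (hi₀ : s i₀ < t i₀) (hf : ∀ x ∈ descentCone s t, f x ≤ 0) (i j : ι) (z : ℂ) :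
    f (single j i (star z)) = f (single i j z) := by
  have := polar_skew hs hst hi₀ hf (F := single i j z - single j i (star z)) (by
    rw [conjTranspose_sub, conjTranspose_single, conjTranspose_single, star_star, neg_sub])
  rw [map_sub] at this
  linarith

theorem polar_single_of_slack (hs : ∀ i, 0 ≤ s i) (hst : ∀ i, s i ≤ t i)
    (hf : ∀ x ∈ descentCone s t, f x ≤ 0) {i j : ι} (hij : i ≠ j) (htij : t i = t j)
    (hj : s j < t j) (z : ℂ) : f (single i j z) = 0 := by
  have key : ∀ z : ℂ, f (single i j z) ≤ 0 := by
    intro z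
    have main : ∀ η : ℝ, 0 < η →
        2 * f (single i j z) + η * (f (single i i 1) - f (single j j 1)) ≤ 0 := by
      intro η hη
      have hd := sub_pos.2 hj
      set E : Matrix ι ι ℂ := single i j z + single j i (star z) + η • single i i 1
        - η • single j j 1 with hE
      have hEH : Eᴴ = E := by
        simp only [hE, conjTranspose_sub, conjTranspose_add, conjTranspose_smul,
          conjTranspose_single, star_star, star_trivial, star_one]
        abel
      set m : ℝ := η + Complex.normSq z / η with hm
      have hm0 : 0 ≤ m := add_nonneg hη.le (div_nonneg (Complex.normSq_nonneg _) hη.le)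
      have hle := polar_nonpos hs hst hj hf (F := E) (m / (t j - s j)) (by
        rw [hermPart_of_isHermitian hEH]
        have p1 := (posSemidef_vecMulVec_self_star
          (Pi.single i 1 + Pi.single j (star z / (η : ℂ)) : ι → ℂ)).real_smul hη.le
        have p2 := posSemidef_diagonal_ofReal
          (s := fun k => m / (t j - s j) * (t k - s k) - if k = j then m else 0) (by
            intro k
            show 0 ≤ m / (t j - s j) * (t k - s k) - if k = j then m else 0
            split_ifs with h
            · subst h; rw [div_mul_cancel₀ _ hd.ne']; simp
            · have := sub_nonneg.2 (hst k)
              rw [sub_zero]; positivity)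
        convert p1.add p2 using 1
        have hηC : (η : ℂ) ≠ 0 := by exact_mod_cast hη.ne'
        ext k l
        have hz : (Complex.normSq z : ℂ) = star z * z := Complex.normSq_eq_conj_mul_self
        by_cases hkl : k = l
        · subst hkl
          by_cases hki : k = i
          · subst hki
            simp [hE, hij, hij.symm, vecMulVec_apply, single_apply]
          · by_cases hkj : k = j
            · subst hkj
              simp [hE, hij, hij.symm, vecMulVec_apply, single_apply, hm, hz, hki]
              field_simp
              ring
            · simp [hE, hij, hij.symm, vecMulVec_apply, single_apply, Ne.symm hki, Ne.symm hkj, hki, hkj]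
        · by_cases hki : k = i
          · subst hki
            by_cases hlj : l = j
            · subst hlj
              simp [hE, hij, hij.symm, vecMulVec_apply, single_apply]
              field_simp
            · simp [hE, hij, hij.symm, vecMulVec_apply, single_apply, hkl, Ne.symm hkl, hlj, Ne.symm hlj]
          · by_cases hkj : k = j
            · subst hkj
              by_cases hli : l = i
              · subst hli
                simp [hE, hij, hij.symm, vecMulVec_apply, single_apply]
                field_simp
              · simp [hE, hij, hij.symm, vecMulVec_apply, single_apply, hkl, Ne.symm hkl, hli, Ne.symm hli]
            · simp [hE, hij, hij.symm, vecMulVec_apply, single_apply, hkl, Ne.symm hki, Ne.symm hkj, hki, hkj])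
        (by
          have : ∀ k, t k * (E k k).re =
              (if k = i then t i * η else 0) - if k = j then t j * η else 0 := by
            intro k
            by_cases hki : k = i
            · subst hki; simp [hE, hij, hij.symm, single_apply]
            · by_cases hkj : k = j
              · subst hkj; simp [hE, hij, hij.symm, single_apply]
              · simp [hE, single_apply, Ne.symm hki, Ne.symm hkj, hki, hkj]
          simp only [this, Finset.sum_sub_distrib, Finset.sum_ite_eq', Finset.mem_univ, if_true,
            htij, sub_self, le_refl])
      rw [hE, map_sub, map_add, map_add, map_smul, map_smul,
        polar_single_swap hs hst hj hf] at hle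
      simp only [smul_eq_mul] at hle
      linarith
    by_contra! h
    set d := f (single i i 1) - f (single j j 1)
    have h1 := main (f (single i j z) / (|d| + 1)) (by positivity)
    have h2 : f (single i j z) / (|d| + 1) * (|d| + 1) = f (single i j z) :=
      div_mul_cancel₀ _ (by positivity)
    have h3 : 0 < f (single i j z) / (|d| + 1) := by positivity
    nlinarith [neg_abs_le d]
  refine le_antisymm (key z) ?_
  have := key (-z)
  rw [← single_neg, map_neg] at this
  linarith

theorem polar_single (hs : ∀ i, 0 ≤ s i) (hsinj : Function.Injective s) (hst : ∀ i, s i ≤ t i)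
    {i₀ : ι} (hi₀ : s i₀ < t i₀) (hf : ∀ x ∈ descentCone s t, f x ≤ 0)
    (hfK : ∀ K : Matrix ι ι ℂ, Kᴴ = -K → f (K * diagonal fun i => (t i : ℂ)) = 0)
    {i j : ι} (hij : i ≠ j) (z : ℂ) : f (single i j z) = 0 := by
  by_cases htij : t i = t j
  · by_cases hj : s j < t j
    · exact polar_single_of_slack hs hst hf hij htij hj z
    · have hi : s i < t i := by
        refine lt_of_le_of_ne (hst i) fun h => hij (hsinj ?_)
        rw [h, htij]
        exact le_antisymm (not_lt.1 hj) (hst j)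
      rw [← polar_single_swap hs hst hi₀ hf]
      exact polar_single_of_slack hs hst hf hij.symm htij.symm hi _
  · have h := hfK (single i j z - single j i (star z)) (by
      rw [conjTranspose_sub, conjTranspose_single, conjTranspose_single, star_star, neg_sub])
    have e : (single i j z - single j i (star z)) * diagonal (fun i => (t i : ℂ)) =
        t j • single i j z - t i • single j i (star z) := by
      ext k l
      rw [mul_diagonal]
      simp only [sub_apply, smul_apply, single_apply, Complex.real_smul, sub_mul]
      congr 1
      · split_ifs with h
        · rw [h.2, mul_comm]
        · simp
      · split_ifs with h
        · rw [h.2, mul_comm]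
        · simp
    rw [e, map_sub, map_smul, map_smul, polar_single_swap hs hst hi₀ hf, smul_eq_mul, smul_eq_mul,
      ← sub_mul, mul_eq_zero] at h
    exact h.resolve_left (sub_ne_zero.2 (Ne.symm htij))

theorem polar_eq_sum (hs : ∀ i, 0 ≤ s i) (hsinj : Function.Injective s) (hst : ∀ i, s i ≤ t i)
    {i₀ : ι} (hi₀ : s i₀ < t i₀) (hf : ∀ x ∈ descentCone s t, f x ≤ 0)
    (hfK : ∀ K : Matrix ι ι ℂ, Kᴴ = -K → f (K * diagonal fun i => (t i : ℂ)) = 0)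
    (E : Matrix ι ι ℂ) : f E = ∑ i, f (single i i 1) * (E i i).re := by
  conv_lhs => rw [matrix_eq_sum_single E, map_sum]
  refine Finset.sum_congr rfl fun i _ => ?_
  rw [map_sum, Finset.sum_eq_single i
    (fun j _ hj => polar_single hs hsinj hst hi₀ hf hfK hj.symm _) (by simp)]
  have e : single i i (E i i) = (E i i).re • single i i 1 +
      (E i i).im • single i i Complex.I := by
    ext k l
    simp only [add_apply, smul_apply, single_apply, Complex.real_smul]
    split_ifs
    · rw [mul_one, Complex.re_add_im]
    · simp
  rw [e, map_add, map_smul, map_smul, polar_skew hs hst hi₀ hf (F := single i i Complex.I) (by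
    rw [conjTranspose_single, RCLike.star_def, Complex.conj_I, single_neg]), smul_zero, add_zero,
    smul_eq_mul, mul_comm]

end Polar

/-- Second-order necessary condition at a minimizer: there is a nonzero diagonal multiplier
intertwining the diagonal blocks. -/
theorem exists_multiplier (P Q : Matrix ι ι ℂ) (s t : ι → ℝ) (hs : ∀ i, 0 ≤ s i)
    (hsinj : Function.Injective s) (hst : ∀ i, s i ≤ t i) {i₀ : ι} (hi₀ : s i₀ < t i₀)
    (hmin : ∀ W : Matrix (ι ⊕ ι) (ι ⊕ ι) ℂ, W * Wᴴ = 1 →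
      (hermPart (W * fromBlocks P (diagonal fun i => (t i : ℂ)) (diagonal fun i => (t i : ℂ)) Q
        * Wᴴ).toBlocks₁₂ - diagonal fun i => (s i : ℂ)).PosSemidef →
      ∑ i, t i ^ 2 ≤ frobSq (W * fromBlocks P (diagonal fun i => (t i : ℂ))
        (diagonal fun i => (t i : ℂ)) Q * Wᴴ).toBlocks₁₂)
    (M : Matrix (ι ⊕ ι) (ι ⊕ ι) ℂ)
    (hM : M = fromBlocks P (diagonal fun i => (t i : ℂ)) (diagonal fun i => (t i : ℂ)) Q)
    (K : Matrix (ι ⊕ ι) (ι ⊕ ι) ℂ) (hK : Kᴴ = -K) (hKM : (K * M - M * K).toBlocks₁₂ = 0) :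
    ∃ g : ι → ℝ, g ≠ 0 ∧ 0 ≤ g i₀ ∧ (∀ i j, Q i j * g j = g i * P i j) ∧
      0 ≤ ∑ i, g i * ((((1 / 2 : ℂ) • (K * (K * M - M * K) - (K * M - M * K) * K)).toBlocks₁₂)
        i i).re := by
  let V : Submodule ℝ (Matrix ι ι ℂ) :=
    { carrier := {E | ∃ L : Matrix (ι ⊕ ι) (ι ⊕ ι) ℂ, Lᴴ = -L ∧ E = (L * M - M * L).toBlocks₁₂}
      add_mem' := by
        rintro _ _ ⟨L, hL, rfl⟩ ⟨L', hL', rfl⟩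
        refine ⟨L + L', by rw [conjTranspose_add, hL, hL', neg_add], ?_⟩
        rw [add_mul, mul_add, add_sub_add_comm]; rfl
      zero_mem' := ⟨0, by simp, by simp; rfl⟩
      smul_mem' := by
        rintro c _ ⟨L, hL, rfl⟩
        refine ⟨c • L, by rw [conjTranspose_smul, hL, star_trivial, smul_neg], ?_⟩
        rw [smul_mul_assoc, mul_smul_comm, ← smul_sub]; rfl }
  obtain ⟨f, hf0, hfC, hfV, hfe⟩ := exists_functional_of_disjoint_cone (isOpen_descentCone s t)
    (convex_descentCone s t) (nonempty_descentCone hs hst hi₀)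
    (fun x hx r hr => smul_mem_descentCone hx r hr) V
    (((1 / 2 : ℂ) • (K * (K * M - M * K) - (K * M - M * K) * K)).toBlocks₁₂) (by
      rintro _ ⟨L, hL, rfl⟩ ⟨c, η, hη, hpsd, htr⟩
      exact no_descent P Q s t hst hmin M hM K L hK hL hKM _ rfl c η hη hpsd htr)
  have hfK : ∀ K : Matrix ι ι ℂ, Kᴴ = -K → f (K * diagonal fun i => (t i : ℂ)) = 0 := by
    intro K hK
    refine hfV _ ⟨fromBlocks K 0 0 0, ?_, ?_⟩
    · simp [fromBlocks_conjTranspose, hK, fromBlocks_neg]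
    · rw [hM, fromBlocks_multiply, fromBlocks_multiply, sub_eq_add_neg, fromBlocks_neg,
        fromBlocks_add, toBlocks_fromBlocks₁₂]
      simp
  have hsum := polar_eq_sum hs hsinj hst hi₀ hfC hfK
  refine ⟨fun i => f (single i i 1), ?_, ?_, ?_, ?_⟩
  · intro hg
    apply hf0
    ext E
    rw [hsum]
    have : ∀ i, f (single i i 1) = 0 := congrFun hg
    simp [this]
  · have := polar_nonpos hs hst hi₀ hfC (F := -single i₀ i₀ 1) (1 / (t i₀ - s i₀)) (by
      have hd := sub_pos.2 hi₀
      rw [hermPart_of_isHermitian (by simp)]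
      convert posSemidef_diagonal_ofReal
        (s := fun k => 1 / (t i₀ - s i₀) * (t k - s k) - if k = i₀ then 1 else 0) ?_ using 1
      · ext k l
        by_cases hkl : k = l
        · subst hkl
          by_cases hk : k = i₀
          · simp [hk]; ring
          · simp [hk, Ne.symm hk, single_apply]
        · have : ¬ (i₀ = k ∧ i₀ = l) := fun h => hkl (h.1.symm.trans h.2)
          simp [hkl, single_apply, this]
      · intro k
        show 0 ≤ 1 / (t i₀ - s i₀) * (t k - s k) - if k = i₀ then 1 else 0
        split_ifs with h
        · subst h; rw [div_mul_cancel₀ _ hd.ne']; simp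
        · have := sub_nonneg.2 (hst k)
          rw [sub_zero]; positivity) (by
      have : ∀ k, t k * ((-single i₀ i₀ 1 : Matrix ι ι ℂ) k k).re = if k = i₀ then - t i₀ else 0 := by
        intro k
        by_cases hk : k = i₀
        · simp [hk]
        · simp [hk, Ne.symm hk, single_apply]
      simp only [this, Finset.sum_ite_eq', Finset.mem_univ, if_true]
      linarith [hs i₀])
    rw [map_neg] at this
    show 0 ≤ f _
    linarith
  · intro i j
    have key : ∀ z : ℂ, (z * (Q i j * f (single j j 1) - f (single i i 1) * P i j)).re = 0 := by
      intro z
      have h := hfV (single j i z * Q - P * single j i z)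
        ⟨fromBlocks 0 (single j i z) (-(single j i z)ᴴ) 0, by
          simp [fromBlocks_conjTranspose, fromBlocks_neg], by
          rw [hM, fromBlocks_multiply, fromBlocks_multiply,
            sub_eq_add_neg (fromBlocks _ _ _ _), fromBlocks_neg, fromBlocks_add,
            toBlocks_fromBlocks₁₂]
          simp [sub_eq_add_neg]⟩
      rw [hsum] at h
      have e : ∀ k, f (single k k 1) * ((single j i z * Q - P * single j i z) k k).re =
          (if k = j then f (single j j 1) * (z * Q i j).re else 0) -
            if k = i then f (single i i 1) * (P i j * z).re else 0 := by
        intro k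
        have e1 : (single j i z * Q) k k = if k = j then z * Q i j else 0 := by
          split_ifs with hk
          · subst hk; simp
          · exact single_mul_apply_of_ne _ _ _ _ _ hk _
        have e2 : (P * single j i z) k k = if k = i then P i j * z else 0 := by
          split_ifs with hk
          · subst hk; simp
          · exact mul_single_apply_of_ne _ _ _ _ _ hk _
        have e3 : f (single k k 1) * (if k = j then z * Q i j else 0).re =
            if k = j then f (single j j 1) * (z * Q i j).re else 0 := by
          split_ifs with hk
          · rw [hk]
          · simp
        have e4 : f (single k k 1) * (if k = i then P i j * z else 0).re =
            if k = i then f (single i i 1) * (P i j * z).re else 0 := by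
          split_ifs with hk
          · rw [hk]
          · simp
        rw [sub_apply, e1, e2, Complex.sub_re, mul_sub, e3, e4]
      simp only [e, Finset.sum_sub_distrib, Finset.sum_ite_eq', Finset.mem_univ, if_true] at h
      rw [← h]
      simp
      ring
    rw [← sub_eq_zero]
    have h1 := key (star (Q i j * f (single j j 1) - f (single i i 1) * P i j))
    rw [RCLike.star_def, ← Complex.normSq_eq_conj_mul_self, Complex.ofReal_re] at h1
    exact Complex.normSq_eq_zero.1 h1
  · rw [← hsum]; exact hfe

/-- No proper nonempty set of indices is decoupled from its complement in both matrices. -/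
def JointlyIrreducible (P Q : Matrix ι ι ℂ) : Prop :=
  ∀ S : ι → Prop, (∀ i j, S i → ¬ S j → P i j = 0 ∧ Q i j = 0) → (∀ i, S i) ∨ ∀ i, ¬ S i

theorem JointlyIrreducible.exists_sign {P Q : Matrix ι ι ℂ} (hirr : JointlyIrreducible P Q)
    (hP : P.IsHermitian) (hQ : Q.IsHermitian) {g : ι → ℝ} (hg : g ≠ 0) {i₀ : ι} (hi₀ : 0 ≤ g i₀)
    (hPQ : ∀ i j, Q i j * g j = g i * P i j) :
    ∃ (γ : ℝ) (ε : ι → ℝ), 0 < γ ∧ (∀ i, ε i * ε i = 1) ∧ ε i₀ = 1 ∧ (∀ i, g i = γ * ε i) ∧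
      ∀ i j, Q i j = ε i * P i j * ε j := by
  have hPQ' : ∀ i j, Q i j * g i = g j * P i j := by
    intro i j
    have := congrArg star (hPQ j i)
    simp only [star_mul', RCLike.star_def, Complex.conj_ofReal] at this
    rwa [← RCLike.star_def, hP.apply, hQ.apply] at this
  obtain ⟨k, hk⟩ : ∃ k, g k ≠ 0 := by
    by_contra! h
    exact hg (funext h)
  have hall : ∀ i, g i ^ 2 = g k ^ 2 := by
    refine (hirr (fun i => g i ^ 2 = g k ^ 2) ?_).resolve_right fun h => h k rfl
    intro i j hi hj
    have hne : ((g i : ℂ) ^ 2 - (g j : ℂ) ^ 2) ≠ 0 := by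
      rw [sub_ne_zero]
      intro h
      refine hj ?_
      rw [← hi]
      exact_mod_cast h.symm
    constructor
    · refine (mul_eq_zero.1 (?_ : ((g i : ℂ) ^ 2 - (g j : ℂ) ^ 2) * P i j = 0)).resolve_left hne
      linear_combination g j * hPQ' i j - g i * hPQ i j
    · refine (mul_eq_zero.1 (?_ : ((g i : ℂ) ^ 2 - (g j : ℂ) ^ 2) * Q i j = 0)).resolve_left hne
      linear_combination g i * hPQ' i j - g j * hPQ i j
  have habs : ∀ i, |g i| = |g k| := fun i => (sq_eq_sq_iff_abs_eq_abs _ _).1 (hall i)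
  have hγ : 0 < |g k| := abs_pos.2 hk
  have hε : ∀ i, g i / |g k| * (g i / |g k|) = 1 := by
    intro i
    rw [← habs i, div_mul_div_comm, abs_mul_abs_self, div_self]
    refine mul_self_ne_zero.2 fun h => ?_
    have := habs i
    rw [h, abs_zero] at this
    exact hγ.ne this
  refine ⟨|g k|, fun i => g i / |g k|, hγ, hε, ?_, fun i => (mul_div_cancel₀ _ hγ.ne').symm, ?_⟩
  · show g i₀ / |g k| = 1
    rw [← habs i₀, abs_of_nonneg hi₀, div_self]
    intro h
    have := habs i₀
    rw [h, abs_zero] at this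
    exact hγ.ne this
  · intro i j
    have h1 : ((g j / |g k| : ℝ) : ℂ) * ((g j / |g k| : ℝ) : ℂ) = 1 := by exact_mod_cast hε j
    have h2 := hPQ i j
    have hγC : ((|g k| : ℝ) : ℂ) ≠ 0 := by exact_mod_cast hγ.ne'
    have h3 : Q i j * ((g j / |g k| : ℝ) : ℂ) = ((g i / |g k| : ℝ) : ℂ) * P i j := by
      push_cast
      field_simp
      linear_combination h2
    linear_combination ((g j / |g k| : ℝ) : ℂ) * h3 - Q i j * h1

theorem JointlyIrreducible.sign_unique {P Q : Matrix ι ι ℂ} (hirr : JointlyIrreducible P Q)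
    {ε ε' : ι → ℝ} (hε : ∀ i, ε i * ε i = 1) (hε' : ∀ i, ε' i * ε' i = 1) {i₀ : ι}
    (h₀ : ε i₀ = ε' i₀) (h : ∀ i j, Q i j = ε i * P i j * ε j)
    (h' : ∀ i j, Q i j = ε' i * P i j * ε' j) : ε = ε' := by
  refine funext ((hirr (fun i => ε i = ε' i) ?_).resolve_right fun h => h i₀ h₀)
  intro i j hi hj
  have hj' : ε' j = - ε j := by
    have : (ε j - ε' j) * (ε j + ε' j) = 0 := by linear_combination hε j - hε' j
    rcases mul_eq_zero.1 this with h | h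
    · exact absurd (sub_eq_zero.1 h) hj
    · linarith
  have h1 := h i j
  have h2 := h' i j
  rw [hj', ← hi] at h2
  push_cast at h2
  have hQ0 : Q i j = 0 := by linear_combination (1 / 2 : ℂ) * h1 + (1 / 2 : ℂ) * h2
  refine ⟨?_, hQ0⟩
  have hi1 : (ε i : ℂ) * ε i = 1 := by exact_mod_cast hε i
  have hj1 : (ε j : ℂ) * ε j = 1 := by exact_mod_cast hε j
  rw [hQ0] at h1
  linear_combination (-(P i j)) * hi1 - P i j * (ε i : ℂ) * ε i * hj1 - (ε i : ℂ) * ε j * h1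

/-- Every eigenspace of `M` is at most one-dimensional. -/
def SimpleSpec (M : Matrix κ κ ℂ) : Prop :=
  ∀ (c : ℂ) (x y : κ → ℂ), M *ᵥ x = c • x → M *ᵥ y = c • y → star x ⬝ᵥ y = 0 → x = 0 ∨ y = 0

/-- At a minimizer with simple spectrum and jointly irreducible diagonal blocks, the constraint
`s ≤ t` is nowhere slack. -/
theorem irreducible_not_slack {P Q : Matrix ι ι ℂ} {s t : ι → ℝ} (hirr : JointlyIrreducible P Q)
    (hP : P.IsHermitian) (hQ : Q.IsHermitian) (hs : ∀ i, 0 ≤ s i)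
    (hsinj : Function.Injective s) (hst : ∀ i, s i ≤ t i) {i₀ : ι} (hi₀ : s i₀ < t i₀)
    (hmin : ∀ W : Matrix (ι ⊕ ι) (ι ⊕ ι) ℂ, W * Wᴴ = 1 →
      (hermPart (W * fromBlocks P (diagonal fun i => (t i : ℂ)) (diagonal fun i => (t i : ℂ)) Q
        * Wᴴ).toBlocks₁₂ - diagonal fun i => (s i : ℂ)).PosSemidef →
      ∑ i, t i ^ 2 ≤ frobSq (W * fromBlocks P (diagonal fun i => (t i : ℂ))
        (diagonal fun i => (t i : ℂ)) Q * Wᴴ).toBlocks₁₂)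
    (hspec : SimpleSpec
      (fromBlocks P (diagonal fun i => (t i : ℂ)) (diagonal fun i => (t i : ℂ)) Q)) : False := by
  obtain ⟨g, hg, hg0, hgPQ, -⟩ := exists_multiplier P Q s t hs hsinj hst hi₀ hmin _ rfl 0
    (by simp) (by simp; rfl)
  obtain ⟨γ, ε, hγ, hε, hε0, -, hεPQ⟩ := hirr.exists_sign hP hQ hg hg0 hgPQ
  set D : Matrix ι ι ℂ := diagonal fun i => (ε i : ℂ) with hD
  set R : Matrix ι ι ℂ := diagonal fun i => ((ε i * t i : ℝ) : ℂ) with hR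
  have hεC : ∀ i, (ε i : ℂ) * ε i = 1 := fun i => by exact_mod_cast hε i
  have hDD : D * D = 1 := by
    rw [hD, diagonal_mul_diagonal, ← diagonal_one]; congr 1; funext i; exact hεC i
  have hDH : Dᴴ = D := isHermitian_diagonal_ofReal ε
  have hTR : (diagonal fun i => (t i : ℂ)) = R * D := by
    rw [hD, hR, diagonal_mul_diagonal]; congr 1; funext i; push_cast
    linear_combination (-(t i : ℂ)) * hεC i
  have hTR' : (diagonal fun i => (t i : ℂ)) = D * R := by
    rw [hD, hR, diagonal_mul_diagonal]; congr 1; funext i; push_cast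
    linear_combination (-(t i : ℂ)) * hεC i
  have hQD : Q = D * P * D := by
    ext i j
    rw [hD, mul_diagonal, diagonal_mul, hεPQ]
  set M := fromBlocks P (diagonal fun i => (t i : ℂ)) (diagonal fun i => (t i : ℂ)) Q with hM
  have hM' : M = fromBlocks P (R * D) (D * R) (D * P * D) := by
    rw [hM, ← hTR, ← hTR', ← hQD]
  obtain ⟨a, b, ha, hb, hab, hpos⟩ := exists_skew_hermitian_pair P hP (fun i => ε i * t i)
    ⟨i₀, by rw [hε0, one_mul]; exact (hs i₀).trans (hst i₀)⟩ (by
      intro c x y hx hy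
      have hx' : P *ᵥ x + R *ᵥ x = c • x := by rw [← add_mulVec]; exact hx
      have hy' : P *ᵥ y - R *ᵥ y = c • y := by rw [← sub_mulVec]; exact hy
      have hDDv : ∀ v : ι → ℂ, D *ᵥ D *ᵥ v = v := fun v => by
        rw [mulVec_mulVec, hDD, one_mulVec]
      have h := hspec c (Sum.elim x (D *ᵥ x)) (Sum.elim y (-(D *ᵥ y))) (by
        rw [hM', fromBlocks_mulVec, Sum.elim_comp_inl, Sum.elim_comp_inr]
        simp only [← mulVec_mulVec, hDDv]
        rw [← mulVec_add, add_comm (R *ᵥ x), hx', mulVec_smul]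
        funext i; cases i <;> simp) (by
        rw [hM', fromBlocks_mulVec, Sum.elim_comp_inl, Sum.elim_comp_inr]
        simp only [← mulVec_mulVec, mulVec_neg, hDDv]
        rw [← sub_eq_add_neg, ← sub_eq_add_neg, ← mulVec_sub, ← neg_sub (P *ᵥ y), hy', mulVec_neg,
          mulVec_smul]
        funext i; cases i <;> simp) (by
        have : star (D *ᵥ x) ⬝ᵥ (D *ᵥ y) = star x ⬝ᵥ y := by
          rw [star_mulVec, hDH, ← dotProduct_mulVec, hDDv]
        have e : star (Sum.elim x (D *ᵥ x)) = Sum.elim (star x) (star (D *ᵥ x)) := by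
          funext i; cases i <;> rfl
        rw [e, sumElim_dotProduct_sumElim, dotProduct_neg, this, add_neg_cancel])
      refine h.imp (fun h => ?_) (fun h => ?_)
      · funext i; exact congrFun h (Sum.inl i)
      · funext i; exact congrFun h (Sum.inl i))
  set c1 : Matrix ι ι ℂ := a * P - P * a + (b * R + R * b) with hc1
  set J : Matrix (ι ⊕ ι) (ι ⊕ ι) ℂ := fromBlocks 1 0 0 D with hJ
  have hJJ : J * J = 1 := by
    rw [hJ, fromBlocks_multiply, ← fromBlocks_one]; simp [hDD]
  have hJH : Jᴴ = J := by rw [hJ, fromBlocks_conjTranspose]; simp [hDH]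
  set M0 : Matrix (ι ⊕ ι) (ι ⊕ ι) ℂ := fromBlocks P R R P with hM0
  set K0 : Matrix (ι ⊕ ι) (ι ⊕ ι) ℂ := fromBlocks a b (-b) (-a) with hK0
  have hMJ : M = J * M0 * J := by
    rw [hM', hJ, hM0, fromBlocks_multiply, fromBlocks_multiply]; simp
  have hK0H : K0ᴴ = -K0 := by
    rw [hK0, fromBlocks_conjTranspose, fromBlocks_neg]; simp [ha, hb]
  have hconj : ∀ A B : Matrix (ι ⊕ ι) (ι ⊕ ι) ℂ, (J * A * J) * (J * B * J) = J * (A * B) * J := by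
    intro A B
    calc (J * A * J) * (J * B * J) = J * A * (J * J) * B * J := by noncomm_ring
      _ = J * (A * B) * J := by rw [hJJ]; noncomm_ring
  have hcomm0 : K0 * M0 - M0 * K0 = fromBlocks c1 0 0 (-c1) := by
    rw [hK0, hM0, fromBlocks_multiply, fromBlocks_multiply, sub_eq_add_neg, fromBlocks_neg,
      fromBlocks_add]
    congr 1
    · rw [hc1]; noncomm_ring
    · rw [← hab]; noncomm_ring
    · rw [← neg_zero, ← hab]; noncomm_ring
    · rw [hc1]; noncomm_ring
  have hcomm : (J * K0 * J) * M - M * (J * K0 * J) = J * fromBlocks c1 0 0 (-c1) * J := by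
    rw [hMJ, hconj, hconj, ← sub_mul, ← mul_sub, hcomm0]
  have hblock : ∀ Z : Matrix (ι ⊕ ι) (ι ⊕ ι) ℂ, (J * Z * J).toBlocks₁₂ = Z.toBlocks₁₂ * D := by
    intro Z
    conv_lhs => rw [← fromBlocks_toBlocks Z, hJ, fromBlocks_multiply, fromBlocks_multiply,
      toBlocks_fromBlocks₁₂]
    simp
  obtain ⟨g', hg', hg0', hgPQ', hge⟩ := exists_multiplier P Q s t hs hsinj hst hi₀ hmin M rfl
    (J * K0 * J) (by
      rw [conjTranspose_mul, conjTranspose_mul, hJH, hK0H]; noncomm_ring)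
    (by rw [hcomm, hblock, toBlocks_fromBlocks₁₂, zero_mul])
  obtain ⟨γ', ε', hγ', hε', hε0', hgε', hεPQ'⟩ := hirr.exists_sign hP hQ hg' hg0' hgPQ'
  obtain rfl : ε = ε' := hirr.sign_unique hε hε' (hε0.trans hε0'.symm) hεPQ hεPQ'
  have he : ((1 / 2 : ℂ) • ((J * K0 * J) * ((J * K0 * J) * M - M * (J * K0 * J)) -
      ((J * K0 * J) * M - M * (J * K0 * J)) * (J * K0 * J))).toBlocks₁₂ =
      (-(1 / 2 : ℂ) • (b * c1 + c1 * b)) * D := by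
    rw [hcomm, hconj, hconj, ← sub_mul, ← mul_sub, ← Matrix.smul_mul, ← Matrix.mul_smul, hblock]
    congr 1
    rw [hK0, fromBlocks_multiply, fromBlocks_multiply, sub_eq_add_neg, fromBlocks_neg,
      fromBlocks_add, fromBlocks_smul, toBlocks_fromBlocks₁₂]
    simp only [mul_zero, zero_add, mul_neg, zero_mul]
    module
  rw [he] at hge
  have hsum : ∑ i, g' i * (((-(1 / 2 : ℂ) • (b * c1 + c1 * b)) * D) i i).re =
      - γ' * (trace (b * c1)).re := by
    have htr : trace (b * c1) = (1 / 2 : ℂ) * trace (b * c1 + c1 * b) := by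
      rw [trace_add, trace_mul_comm c1 b]; ring
    rw [htr, trace, Finset.mul_sum, Complex.re_sum, Finset.mul_sum]
    refine Finset.sum_congr rfl fun i _ => ?_
    rw [hD, mul_diagonal, hgε', smul_apply, smul_eq_mul, diag_apply, Complex.re_mul_ofReal]
    rw [neg_mul, Complex.neg_re]
    linear_combination (-γ' * ((1 / 2 : ℂ) * (b * c1 + c1 * b) i i).re) * hε i
  have htr : trace (b * c1) = 2 * trace ((a * a + b * b) * R) := by
    have h1 : trace (b * (a * P)) = trace (a * (P * b)) := by
      rw [trace_mul_comm b, Matrix.mul_assoc]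
    have h2 : trace (b * (P * a)) = trace (a * (b * P)) := by
      rw [← Matrix.mul_assoc, trace_mul_comm]
    have h3 : trace (a * (R * a)) = trace (a * a * R) := by
      rw [trace_mul_comm, Matrix.mul_assoc, trace_mul_comm]
    have h4 : trace (b * (R * b)) = trace (b * b * R) := by
      rw [trace_mul_comm, Matrix.mul_assoc, trace_mul_comm]
    have h5 : trace (a * (a * R + R * a + (b * P - P * b))) = 0 := by
      rw [hab, mul_zero, trace_zero]
    simp only [mul_add, mul_sub, add_mul, trace_add, trace_sub, hc1, h1, h2, h3, h4] at h5 ⊢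
    simp only [← Matrix.mul_assoc] at h5 ⊢
    linear_combination -h5
  rw [hsum, htr] at hge
  have : (2 * trace ((a * a + b * b) * R)).re = 2 * (trace ((a * a + b * b) * R)).re := by simp
  rw [this] at hge
  nlinarith [mul_pos hγ' hpos]

theorem isCompact_setOf_mul_conjTranspose_eq_one :
    IsCompact {W : Matrix κ κ ℂ | W * Wᴴ = 1} := by
  have hc : IsCompact (Set.pi Set.univ fun _ : κ => Set.pi Set.univ fun _ : κ =>
      Metric.closedBall (0 : ℂ) 1) :=
    isCompact_univ_pi fun _ => isCompact_univ_pi fun _ => isCompact_closedBall _ _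
  refine hc.of_isClosed_subset ?_ ?_
  · exact isClosed_eq (by fun_prop) continuous_const
  · intro W hW i _ j _
    rw [mem_closedBall_zero_iff]
    exact entry_norm_bound_of_unitary (mem_unitaryGroup_iff.2 hW) i j

theorem continuous_hermPart : Continuous (hermPart : Matrix ι ι ℂ → Matrix ι ι ℂ) := by
  unfold hermPart
  fun_prop

theorem isClosed_setOf_posSemidef : IsClosed {X : Matrix ι ι ℂ | X.PosSemidef} := by
  have : {X : Matrix ι ι ℂ | X.PosSemidef} =
      {X | Xᴴ = X} ∩ ⋂ x : ι → ℂ, {X | 0 ≤ star x ⬝ᵥ (X *ᵥ x)} := by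
    ext X
    simp only [Set.mem_inter_iff, Set.mem_iInter, Set.mem_ofPred_eq]
    exact posSemidef_iff_dotProduct_mulVec
  rw [this]
  refine (isClosed_eq (by fun_prop) continuous_id).inter (isClosed_iInter fun x => ?_)
  exact isClosed_le continuous_const (by fun_prop)

theorem continuous_frobSq : Continuous (frobSq : Matrix ι κ ℂ → ℝ) := by
  unfold frobSq
  have := Complex.continuous_normSq
  fun_prop

theorem frobSq_eq_re_trace (X : Matrix ι κ ℂ) : frobSq X = (trace (Xᴴ * X)).re := by
  simp only [frobSq, trace, diag_apply, mul_apply, conjTranspose_apply, Complex.re_sum]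
  rw [Finset.sum_comm]
  refine Finset.sum_congr rfl fun i _ => Finset.sum_congr rfl fun j _ => ?_
  rw [RCLike.star_def, ← Complex.normSq_eq_conj_mul_self, Complex.ofReal_re]

theorem frobSq_unitary_mul_diagonal_mul {u v : Matrix ι ι ℂ} (hu : uᴴ * u = 1) (hv : vᴴ * v = 1)
    (t : ι → ℝ) : frobSq (u * diagonal (fun i => (t i : ℂ)) * vᴴ) = ∑ i, t i ^ 2 := by
  rw [frobSq_eq_re_trace, conjTranspose_mul, conjTranspose_mul, conjTranspose_conjTranspose,
    isHermitian_diagonal_ofReal]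
  have : v * (diagonal (fun i => (t i : ℂ)) * uᴴ) * (u * diagonal (fun i => (t i : ℂ)) * vᴴ) =
      v * (diagonal (fun i => (t i : ℂ)) * (uᴴ * u) * diagonal (fun i => (t i : ℂ)) * vᴴ) := by
    noncomm_ring
  rw [this, hu, mul_one, trace_mul_comm, Matrix.mul_assoc, hv, mul_one, diagonal_mul_diagonal,
    trace_diagonal, Complex.re_sum]
  refine Finset.sum_congr rfl fun i _ => ?_
  rw [← Complex.ofReal_mul, Complex.ofReal_re, sq]

/-- Among the unitary conjugates of `M` whose off-diagonal block has Hermitian part at least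
`diagonal s`, there is one whose off-diagonal block has least Frobenius norm. -/
theorem exists_minimizer (M : Matrix (ι ⊕ ι) (ι ⊕ ι) ℂ) (s : ι → ℝ)
    (h : (hermPart M.toBlocks₁₂ - diagonal fun i => (s i : ℂ)).PosSemidef) :
    ∃ W₀ : Matrix (ι ⊕ ι) (ι ⊕ ι) ℂ, W₀ * W₀ᴴ = 1 ∧
      (hermPart (W₀ * M * W₀ᴴ).toBlocks₁₂ - diagonal fun i => (s i : ℂ)).PosSemidef ∧
      ∀ W : Matrix (ι ⊕ ι) (ι ⊕ ι) ℂ, W * Wᴴ = 1 →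
        (hermPart (W * M * Wᴴ).toBlocks₁₂ - diagonal fun i => (s i : ℂ)).PosSemidef →
        frobSq (W₀ * M * W₀ᴴ).toBlocks₁₂ ≤ frobSq (W * M * Wᴴ).toBlocks₁₂ := by
  have hb : Continuous fun X : Matrix (ι ⊕ ι) (ι ⊕ ι) ℂ => X.toBlocks₁₂ :=
    continuous_pi fun i => continuous_pi fun j => continuous_apply_apply (Sum.inl i) (Sum.inr j)
  have hc : Continuous fun W : Matrix (ι ⊕ ι) (ι ⊕ ι) ℂ => (W * M * Wᴴ).toBlocks₁₂ :=
    hb.comp (by fun_prop)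
  have hclosed : IsClosed {W : Matrix (ι ⊕ ι) (ι ⊕ ι) ℂ |
      (hermPart (W * M * Wᴴ).toBlocks₁₂ - diagonal fun i => (s i : ℂ)).PosSemidef} :=
    isClosed_setOf_posSemidef.preimage ((continuous_hermPart.comp hc).sub continuous_const)
  obtain ⟨W₀, ⟨h1, h2⟩, h3⟩ :=
    (isCompact_setOf_mul_conjTranspose_eq_one.inter_right hclosed).exists_isMinOn
      ⟨1, by simp, by simpa using h⟩ (continuous_frobSq.comp hc).continuousOn
  exact ⟨W₀, h1, h2, fun W hW hW' => h3 ⟨hW, hW'⟩⟩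

theorem SimpleSpec.unitary_conj {M W : Matrix κ κ ℂ} (h : SimpleSpec M) (hW : W * Wᴴ = 1) :
    SimpleSpec (W * M * Wᴴ) := by
  have hW' : Wᴴ * W = 1 := mul_eq_one_comm.1 hW
  have hinj : ∀ x, Wᴴ *ᵥ x = 0 → x = 0 := by
    intro x hx
    rw [← one_mulVec x, ← hW, ← mulVec_mulVec, hx, mulVec_zero]
  have heig : ∀ (c : ℂ) x, (W * M * Wᴴ) *ᵥ x = c • x → M *ᵥ (Wᴴ *ᵥ x) = c • (Wᴴ *ᵥ x) := by
    intro c x hx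
    rw [← mulVec_smul, ← hx, mulVec_mulVec, mulVec_mulVec]
    congr 1
    rw [← Matrix.mul_assoc, ← Matrix.mul_assoc, hW', Matrix.one_mul]
  intro c x y hx hy hxy
  refine (h c _ _ (heig c x hx) (heig c y hy) ?_).imp (hinj x) (hinj y)
  rw [star_mulVec, conjTranspose_conjTranspose, ← dotProduct_mulVec, mulVec_mulVec, hW, one_mulVec,
    hxy]

theorem SimpleSpec.of_submatrix {M : Matrix κ κ ℂ} (e : ι ≃ κ) (h : SimpleSpec M) :
    SimpleSpec (M.submatrix e e) := by
  intro c x y hx hy hxy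
  have heig : ∀ x, (M.submatrix e e) *ᵥ x = c • x → M *ᵥ (x ∘ e.symm) = c • (x ∘ e.symm) := by
    intro x hx
    rw [submatrix_mulVec_equiv] at hx
    funext k
    have := congrFun hx (e.symm k)
    simpa using this
  refine (h c _ _ (heig x hx) (heig y hy) ?_).imp (fun h => ?_) (fun h => ?_)
  · rw [← hxy]
    exact Equiv.sum_comp e.symm fun i => star x i * y i
  · funext i; simpa using congrFun h (e i)
  · funext i; simpa using congrFun h (e i)

theorem SimpleSpec.fromBlocks_left {A : Matrix ι ι ℂ} {B : Matrix κ κ ℂ}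
    (h : SimpleSpec (fromBlocks A 0 0 B)) : SimpleSpec A := by
  intro c x y hx hy hxy
  have heig : ∀ x, A *ᵥ x = c • x →
      fromBlocks A 0 0 B *ᵥ Sum.elim x 0 = c • Sum.elim x (0 : κ → ℂ) := by
    intro x hx
    rw [fromBlocks_mulVec]
    funext k
    cases k <;> simp [hx]
  refine (h c _ _ (heig x hx) (heig y hy) ?_).imp (fun h => ?_) (fun h => ?_)
  · simpa [dotProduct] using hxy
  · funext i; exact congrFun h (Sum.inl i)
  · funext i; exact congrFun h (Sum.inl i)

theorem SimpleSpec.fromBlocks_right {A : Matrix ι ι ℂ} {B : Matrix κ κ ℂ}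
    (h : SimpleSpec (fromBlocks A 0 0 B)) : SimpleSpec B := by
  have := h.of_submatrix (Equiv.sumComm κ ι)
  rw [Equiv.sumComm_apply, fromBlocks_submatrix_sum_swap_sum_swap] at this
  exact this.fromBlocks_left

/-- Solutions on two decoupled sets of indices glue to a solution on all indices. -/
theorem exists_corner_of_decoupled {P Q : Matrix ι ι ℂ} (s t : ι → ℝ) (S : ι → Prop)
    [DecidablePred S]
    (hP : ∀ i j, (S i ↔ S j) ∨ P i j = 0) (hQ : ∀ i j, (S i ↔ S j) ∨ Q i j = 0)
    (hspec : SimpleSpec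
      (fromBlocks P (diagonal fun i => (t i : ℂ)) (diagonal fun i => (t i : ℂ)) Q))
    (hind : ∀ p : ι → Prop, (p = S ∨ p = fun i => ¬ S i) → ∀ [DecidablePred p],
      SimpleSpec (fromBlocks (P.submatrix (Subtype.val : Subtype p → ι) Subtype.val)
        (diagonal fun i : Subtype p => (t i : ℂ)) (diagonal fun i : Subtype p => (t i : ℂ))
        (Q.submatrix (Subtype.val : Subtype p → ι) Subtype.val)) →
      ∃ W : Matrix (Subtype p ⊕ Subtype p) (Subtype p ⊕ Subtype p) ℂ, W * Wᴴ = 1 ∧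
        (W * fromBlocks (P.submatrix (Subtype.val : Subtype p → ι) Subtype.val)
          (diagonal fun i : Subtype p => (t i : ℂ)) (diagonal fun i : Subtype p => (t i : ℂ))
          (Q.submatrix (Subtype.val : Subtype p → ι) Subtype.val) * Wᴴ).toBlocks₁₂ =
          diagonal fun i : Subtype p => (s i : ℂ)) :
    ∃ W : Matrix (ι ⊕ ι) (ι ⊕ ι) ℂ, W * Wᴴ = 1 ∧
      (W * fromBlocks P (diagonal fun i => (t i : ℂ)) (diagonal fun i => (t i : ℂ)) Q
        * Wᴴ).toBlocks₁₂ = diagonal fun i => (s i : ℂ) := by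
  let e : (Subtype S ⊕ Subtype S) ⊕ ({i // ¬ S i} ⊕ {i // ¬ S i}) ≃ ι ⊕ ι :=
    (Equiv.sumSumSumComm _ _ _ _).trans
      (Equiv.sumCongr (Equiv.sumCompl S) (Equiv.sumCompl S))
  set M := fromBlocks P (diagonal fun i => (t i : ℂ)) (diagonal fun i => (t i : ℂ)) Q with hM
  set M₁ := fromBlocks (P.submatrix (Subtype.val : Subtype S → ι) Subtype.val)
        (diagonal fun i : Subtype S => (t i : ℂ)) (diagonal fun i : Subtype S => (t i : ℂ))
        (Q.submatrix (Subtype.val : Subtype S → ι) Subtype.val) with hM₁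
  set M₂ := fromBlocks (P.submatrix (Subtype.val : {i // ¬ S i} → ι) Subtype.val)
        (diagonal fun i : {i // ¬ S i} => (t i : ℂ)) (diagonal fun i : {i // ¬ S i} => (t i : ℂ))
        (Q.submatrix (Subtype.val : {i // ¬ S i} → ι) Subtype.val) with hM₂
  have hMe : M.submatrix e e = fromBlocks M₁ 0 0 M₂ := by
    have h1 : ∀ (i : Subtype S) (j : {i // ¬ S i}), (i : ι) ≠ j := fun i j h => j.2 (h ▸ i.2)
    have h2 : ∀ (i : Subtype S) (j : {i // ¬ S i}), (j : ι) ≠ i := fun i j h => j.2 (h ▸ i.2)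
    have h3 : ∀ (i : Subtype S) (j : {i // ¬ S i}), P i j = 0 := fun i j =>
      (hP i j).resolve_left fun h => j.2 (h.1 i.2)
    have h4 : ∀ (i : Subtype S) (j : {i // ¬ S i}), P j i = 0 := fun i j =>
      (hP j i).resolve_left fun h => j.2 (h.2 i.2)
    have h5 : ∀ (i : Subtype S) (j : {i // ¬ S i}), Q i j = 0 := fun i j =>
      (hQ i j).resolve_left fun h => j.2 (h.1 i.2)
    have h6 : ∀ (i : Subtype S) (j : {i // ¬ S i}), Q j i = 0 := fun i j =>
      (hQ j i).resolve_left fun h => j.2 (h.2 i.2)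
    ext k l
    rcases k with (k | k) | (k | k) <;> rcases l with (l | l) | (l | l) <;>
      simp [e, hM, hM₁, hM₂, diagonal_apply, h1, h2, h3, h4, h5, h6, Subtype.ext_iff]
  have hspec' := hspec.of_submatrix e
  rw [hMe] at hspec'
  obtain ⟨W₁, hW₁, hb₁⟩ := hind S (Or.inl rfl) hspec'.fromBlocks_left
  obtain ⟨W₂, hW₂, hb₂⟩ := hind (fun i => ¬ S i) (Or.inr rfl) hspec'.fromBlocks_right
  have hMe' : M = (fromBlocks M₁ 0 0 M₂).submatrix e.symm e.symm := by
    rw [← hMe]; simp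
  refine ⟨(fromBlocks W₁ 0 0 W₂).submatrix e.symm e.symm, ?_, ?_⟩
  · rw [conjTranspose_submatrix, submatrix_mul_equiv, fromBlocks_conjTranspose,
      fromBlocks_multiply]
    simp [hW₁, hW₂]
  · rw [hMe', conjTranspose_submatrix, submatrix_mul_equiv, submatrix_mul_equiv,
      fromBlocks_conjTranspose, fromBlocks_multiply, fromBlocks_multiply]
    simp only [Matrix.mul_zero, Matrix.zero_mul, add_zero, zero_add, conjTranspose_zero]
    have hb₁' : ∀ i j, (W₁ * M₁ * W₁ᴴ) (Sum.inl i) (Sum.inr j) =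
        diagonal (fun i : Subtype S => (s i : ℂ)) i j := fun i j =>
      congrFun (congrFun hb₁ i) j
    have hb₂' : ∀ i j, (W₂ * M₂ * W₂ᴴ) (Sum.inl i) (Sum.inr j) =
        diagonal (fun i : {i // ¬ S i} => (s i : ℂ)) i j := fun i j =>
      congrFun (congrFun hb₂ i) j
    ext i j
    obtain ⟨i, rfl⟩ := (Equiv.sumCompl S).surjective i
    obtain ⟨j, rfl⟩ := (Equiv.sumCompl S).surjective j
    have key : ∀ (A : Matrix (Subtype S ⊕ Subtype S) (Subtype S ⊕ Subtype S) ℂ)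
      (B : Matrix ({i // ¬ S i} ⊕ {i // ¬ S i}) ({i // ¬ S i} ⊕ {i // ¬ S i}) ℂ),
      ((fromBlocks A 0 0 B).submatrix e.symm e.symm).toBlocks₁₂
        (Equiv.sumCompl S i) (Equiv.sumCompl S j) =
      fromBlocks A 0 0 B (Equiv.sumSumSumComm _ _ _ _ (Sum.inl i))
        (Equiv.sumSumSumComm _ _ _ _ (Sum.inr j)) := by
      intro A B
      simp [e, toBlocks₁₂]
    rw [key]
    have h1 : ∀ (i : Subtype S) (j : {i // ¬ S i}), (i : ι) ≠ j := fun i j h => j.2 (h ▸ i.2)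
    have h2 : ∀ (i : Subtype S) (j : {i // ¬ S i}), (j : ι) ≠ i := fun i j h => j.2 (h ▸ i.2)
    rcases i with i | i <;> rcases j with j | j
    · simp [hb₁', diagonal_apply, Subtype.ext_iff]
    · simp [h1]
    · simp [h2]
    · simp [hb₂', diagonal_apply, Subtype.ext_iff]

/-- If the spectrum of `M` is simple and `diagonal s` is dominated by the Hermitian part of the
off-diagonal block of `M`, then some unitary conjugate of `M` has off-diagonal block exactly
`diagonal s`. -/
theorem exists_unitary_corner_eq_diagonal (N : ℕ) : ∀ (ι : Type) [Fintype ι] [DecidableEq ι],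
    Fintype.card ι = N → ∀ (M : Matrix (ι ⊕ ι) (ι ⊕ ι) ℂ) (s : ι → ℝ), M.IsHermitian →
    SimpleSpec M → (∀ i, 0 ≤ s i) → Function.Injective s →
    (hermPart M.toBlocks₁₂ - diagonal fun i => (s i : ℂ)).PosSemidef →
    ∃ W : Matrix (ι ⊕ ι) (ι ⊕ ι) ℂ, W * Wᴴ = 1 ∧
      (W * M * Wᴴ).toBlocks₁₂ = diagonal fun i => (s i : ℂ) := by
  induction N using Nat.strong_induction_on with
  | _ N ih =>
  intro ι _ _ hcard M s hM hspec hs hsinj hpsd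
  obtain ⟨W₀, hW₀, hpsd₀, hmin₀⟩ := exists_minimizer M s hpsd
  obtain ⟨t, u, v, hst, hu, hu', hv, hv', hX⟩ := exists_svd_of_le_re _ s hs hpsd₀
  set W₁ := fromBlocks uᴴ 0 0 vᴴ * W₀ with hW₁
  have hW₁u : W₁ * W₁ᴴ = 1 := by
    rw [hW₁, conjTranspose_mul, Matrix.mul_assoc, ← Matrix.mul_assoc W₀, hW₀, Matrix.one_mul,
      fromBlocks_conjTranspose, fromBlocks_multiply]
    simp [hu', hv']
  set M₁ := W₁ * M * W₁ᴴ with hM₁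
  have hM₁H : M₁.IsHermitian := isHermitian_mul_mul_conjTranspose W₁ hM
  have hM₁12 : M₁.toBlocks₁₂ = diagonal fun i => (t i : ℂ) := by
    have e1 : M₁ = fromBlocks uᴴ 0 0 vᴴ * (W₀ * M * W₀ᴴ) * fromBlocks u 0 0 v := by
      rw [hM₁, hW₁, conjTranspose_mul, fromBlocks_conjTranspose]
      simp [Matrix.mul_assoc]
    rw [e1, ← fromBlocks_toBlocks (W₀ * M * W₀ᴴ), fromBlocks_multiply, fromBlocks_multiply,
      toBlocks_fromBlocks₁₂, hX]
    simp only [Matrix.mul_zero, Matrix.zero_mul, add_zero, zero_add]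
    calc uᴴ * (u * diagonal (fun i => (t i : ℂ)) * vᴴ) * v =
        (uᴴ * u) * diagonal (fun i => (t i : ℂ)) * (vᴴ * v) := by noncomm_ring
      _ = _ := by rw [hu', hv', Matrix.one_mul, Matrix.mul_one]
  set P := M₁.toBlocks₁₁ with hPdef
  set Q := M₁.toBlocks₂₂ with hQdef
  have hP : P.IsHermitian := IsHermitian.ext fun i j => hM₁H.apply (Sum.inl i) (Sum.inl j)
  have hQ : Q.IsHermitian := IsHermitian.ext fun i j => hM₁H.apply (Sum.inr i) (Sum.inr j)
  have hM₁b : M₁ = fromBlocks P (diagonal fun i => (t i : ℂ)) (diagonal fun i => (t i : ℂ)) Q := by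
    have h21 : M₁.toBlocks₂₁ = diagonal fun i => (t i : ℂ) := by
      rw [← isHermitian_diagonal_ofReal, ← hM₁12]
      ext i j
      exact (hM₁H.apply (Sum.inr i) (Sum.inl j)).symm
    conv_lhs => rw [← fromBlocks_toBlocks M₁, hM₁12, h21]
  have hspec₁ : SimpleSpec M₁ := hspec.unitary_conj hW₁u
  have hmul : ∀ W : Matrix (ι ⊕ ι) (ι ⊕ ι) ℂ, W * M₁ * Wᴴ = (W * W₁) * M * (W * W₁)ᴴ := by
    intro W
    rw [hM₁, conjTranspose_mul W W₁]
    simp only [Matrix.mul_assoc]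
  have hmulu : ∀ W : Matrix (ι ⊕ ι) (ι ⊕ ι) ℂ, W * Wᴴ = 1 → (W * W₁) * (W * W₁)ᴴ = 1 := by
    intro W hW
    rw [conjTranspose_mul, Matrix.mul_assoc, ← Matrix.mul_assoc W₁, hW₁u, Matrix.one_mul, hW]
  suffices h : ∃ W : Matrix (ι ⊕ ι) (ι ⊕ ι) ℂ, W * Wᴴ = 1 ∧
      (W * M₁ * Wᴴ).toBlocks₁₂ = diagonal fun i => (s i : ℂ) by
    obtain ⟨W, hW, hWb⟩ := h
    exact ⟨W * W₁, hmulu W hW, by rw [← hmul, hWb]⟩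
  by_cases hall : ∀ i, t i = s i
  · refine ⟨1, by simp, ?_⟩
    simp only [Matrix.one_mul, conjTranspose_one, Matrix.mul_one, hM₁12, hall]
  push Not at hall
  obtain ⟨i₀, hi₀⟩ := hall
  have hi₀ : s i₀ < t i₀ := lt_of_le_of_ne (hst i₀) (Ne.symm hi₀)
  by_cases hirr : JointlyIrreducible P Q
  · refine (irreducible_not_slack hirr hP hQ hs hsinj hst hi₀ ?_ (hM₁b ▸ hspec₁)).elim
    intro W hW hWp
    rw [← hM₁b, hmul] at hWp ⊢
    have := hmin₀ _ (hmulu W hW) hWp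
    rwa [hX, frobSq_unitary_mul_diagonal_mul hu' hv'] at this
  unfold JointlyIrreducible at hirr
  push Not at hirr
  obtain ⟨S, hS, ⟨j, hj⟩, ⟨i, hi⟩⟩ := hirr
  classical
  have hcross : ∀ {A : Matrix ι ι ℂ}, A.IsHermitian → (∀ i j, S i → ¬ S j → A i j = 0) →
      ∀ i j, (S i ↔ S j) ∨ A i j = 0 := by
    intro A hA h i j
    by_cases h1 : S i <;> by_cases h2 : S j
    · simp [h1, h2]
    · exact Or.inr (h i j h1 h2)
    · right
      rw [← hA.apply, h j i h2 h1, star_zero]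
    · simp [h1, h2]
  rw [hM₁b]
  refine exists_corner_of_decoupled s t S (hcross hP fun i j h1 h2 => (hS i j h1 h2).1)
    (hcross hQ fun i j h1 h2 => (hS i j h1 h2).2) (hM₁b ▸ hspec₁) ?_
  intro p hp _ hspecp
  refine ih (Fintype.card (Subtype p)) ?_ (Subtype p) rfl _ (fun i => s i) ?_ hspecp
    (fun i => hs i) (hsinj.comp Subtype.val_injective) ?_
  · rw [← hcard]
    rcases hp with rfl | rfl
    · exact Fintype.card_subtype_lt hj
    · exact Fintype.card_subtype_lt (x := i) (not_not.2 hi)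
  · exact IsHermitian.fromBlocks (hP.submatrix _) (isHermitian_diagonal_ofReal _)
      (hQ.submatrix _)
  · rw [toBlocks_fromBlocks₁₂, hermPart_of_isHermitian (isHermitian_diagonal_ofReal _),
      diagonal_sub]
    convert posSemidef_diagonal_ofReal (s := fun i : Subtype p => t i - s i)
      (fun i => sub_nonneg.2 (hst i)) using 1
    ext i j
    simp [diagonal_apply]

theorem simpleSpec_diagonal {d : κ → ℂ} (hd : Function.Injective d) :
    SimpleSpec (diagonal d) := by
  intro c x y hx hy hxy
  by_contra! h
  obtain ⟨k, hk⟩ := Function.ne_iff.1 h.1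
  obtain ⟨l, hl⟩ := Function.ne_iff.1 h.2
  have key : ∀ z : κ → ℂ, diagonal d *ᵥ z = c • z → ∀ k, z k ≠ 0 → d k = c := by
    intro z hz k hk
    have := congrFun hz k
    rw [mulVec_diagonal, Pi.smul_apply, smul_eq_mul] at this
    exact mul_right_cancel₀ hk this
  have hkl : k = l := hd ((key x hx k hk).trans (key y hy l hl).symm)
  subst hkl
  rw [dotProduct, Finset.sum_eq_single k _ (by simp)] at hxy
  · exact (mul_ne_zero (star_ne_zero.2 hk) hl) hxy
  · intro j _ hj
    have : x j = 0 := by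
      by_contra hne
      exact hj (hd ((key x hx j hne).trans (key x hx k hk).symm))
    simp [this]

theorem exists_unitary_corner_of_injective {U V Z : Matrix ι ι ℂ} {a b c : ι → ℝ}
    (hU : U * Uᴴ = 1) (hV : V * Vᴴ = 1) (hZ : Z * Zᴴ = 1)
    (hab : Function.Injective (Sum.elim a b)) (hc : Function.Injective c) (hc0 : ∀ i, 0 ≤ c i)
    (h : (U * diagonal (fun i => (a i : ℂ)) * Uᴴ - V * diagonal (fun i => (b i : ℂ)) * Vᴴ -
      (Z * diagonal (fun i => (c i : ℂ)) * Zᴴ + Z * diagonal (fun i => (c i : ℂ)) * Zᴴ)).PosSemidef) :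
    ∃ W : Matrix (ι ⊕ ι) (ι ⊕ ι) ℂ, W * Wᴴ = 1 ∧
      (W * diagonal (fun i => ((Sum.elim a b i : ℝ) : ℂ)) * Wᴴ).toBlocks₁₂ =
        diagonal fun i => (c i : ℂ) := by
  set A := U * diagonal (fun i => (a i : ℂ)) * Uᴴ with hA
  set B := V * diagonal (fun i => (b i : ℂ)) * Vᴴ with hB
  set C := Z * diagonal (fun i => (c i : ℂ)) * Zᴴ with hC
  have hZ' : Zᴴ * Z = 1 := mul_eq_one_comm.1 hZ
  have hAH : Aᴴ = A := isHermitian_mul_mul_conjTranspose U (isHermitian_diagonal_ofReal a)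
  have hBH : Bᴴ = B := isHermitian_mul_mul_conjTranspose V (isHermitian_diagonal_ofReal b)
  obtain ⟨r, hr⟩ : ∃ r : ℝ, (r : ℂ) * r = 1 / 2 := by
    refine ⟨√(1 / 2), ?_⟩
    rw [← Complex.ofReal_mul, Real.mul_self_sqrt (by norm_num)]
    norm_num
  have hrr : (star (r : ℂ)) = r := by simp
  set J : Matrix (ι ⊕ ι) (ι ⊕ ι) ℂ := (r : ℂ) • fromBlocks 1 1 1 (-1) with hJ
  have hJH : Jᴴ = J := by
    rw [hJ, conjTranspose_smul, hrr, fromBlocks_conjTranspose]; simp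
  have hJJ : J * J = 1 := by
    rw [hJ, Matrix.smul_mul, Matrix.mul_smul, smul_smul, hr, fromBlocks_multiply, fromBlocks_smul,
      ← fromBlocks_one]
    congr 1
    · simp only [mul_one]; module
    · simp
    · simp
    · simp only [mul_one, mul_neg, neg_neg]; module
  set G : Matrix (ι ⊕ ι) (ι ⊕ ι) ℂ := fromBlocks Zᴴ 0 0 Zᴴ * J * fromBlocks U 0 0 V with hG
  have hGH : Gᴴ = fromBlocks Uᴴ 0 0 Vᴴ * J * fromBlocks Z 0 0 Z := by
    simp [hG, conjTranspose_mul, fromBlocks_conjTranspose, hJH, Matrix.mul_assoc]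
  have hGG : G * Gᴴ = 1 := by
    have e1 : fromBlocks U 0 0 V * fromBlocks Uᴴ 0 0 Vᴴ = 1 := by
      rw [fromBlocks_multiply]; simp [hU, hV]
    have e2 : fromBlocks Zᴴ 0 0 Zᴴ * fromBlocks Z 0 0 Z = 1 := by
      rw [fromBlocks_multiply]; simp [hZ']
    calc G * Gᴴ = fromBlocks Zᴴ 0 0 Zᴴ * J * (fromBlocks U 0 0 V * fromBlocks Uᴴ 0 0 Vᴴ) * J *
          fromBlocks Z 0 0 Z := by rw [hGH, hG]; noncomm_ring
      _ = fromBlocks Zᴴ 0 0 Zᴴ * (J * J) * fromBlocks Z 0 0 Z := by rw [e1]; noncomm_ring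
      _ = 1 := by rw [hJJ, Matrix.mul_one, e2]
  set D := diagonal (fun i => ((Sum.elim a b i : ℝ) : ℂ)) with hD
  have hDb : D = fromBlocks (diagonal fun i => (a i : ℂ)) 0 0 (diagonal fun i => (b i : ℂ)) := by
    rw [fromBlocks_diagonal, hD]
    congr 1
    funext i; cases i <;> rfl
  have hcorner : (G * D * Gᴴ).toBlocks₁₂ = Zᴴ * ((1 / 2 : ℂ) • (A - B)) * Z := by
    have e1 : G * D * Gᴴ = fromBlocks Zᴴ 0 0 Zᴴ * (J * fromBlocks A 0 0 B * J) *
        fromBlocks Z 0 0 Z := by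
      have : fromBlocks A 0 0 B = fromBlocks U 0 0 V * D * fromBlocks Uᴴ 0 0 Vᴴ := by
        rw [hDb, fromBlocks_multiply, fromBlocks_multiply, hA, hB]; simp
      rw [this, hGH, hG]; noncomm_ring
    rw [e1, hJ, Matrix.smul_mul, Matrix.mul_smul, Matrix.smul_mul, smul_smul, hr,
      fromBlocks_multiply, fromBlocks_multiply, fromBlocks_smul, fromBlocks_multiply,
      fromBlocks_multiply, toBlocks_fromBlocks₁₂]
    simp [sub_eq_add_neg]
  have hcornerH : (Zᴴ * ((1 / 2 : ℂ) • (A - B)) * Z)ᴴ = Zᴴ * ((1 / 2 : ℂ) • (A - B)) * Z := by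
    rw [conjTranspose_mul, conjTranspose_mul, conjTranspose_conjTranspose, conjTranspose_smul,
      conjTranspose_sub, hAH, hBH, Matrix.mul_assoc]
    simp
  obtain ⟨W, hW, hWc⟩ := exists_unitary_corner_eq_diagonal _ ι rfl (G * D * Gᴴ) c
    (isHermitian_mul_mul_conjTranspose G (isHermitian_diagonal_ofReal (Sum.elim a b)))
    ((simpleSpec_diagonal (Complex.ofReal_injective.comp hab)).unitary_conj hGG) hc0 hc (by
      rw [hcorner, hermPart_of_isHermitian hcornerH]
      have := (h.conjTranspose_mul_mul_same Z).real_smul (c := 1 / 2) (by norm_num)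
      convert this using 1
      have hd : diagonal (fun i => (c i : ℂ)) = Zᴴ * C * Z := by
        calc diagonal (fun i => (c i : ℂ)) = (Zᴴ * Z) * diagonal (fun i => (c i : ℂ)) * (Zᴴ * Z) := by
              rw [hZ', Matrix.one_mul, Matrix.mul_one]
          _ = _ := by rw [hC]; noncomm_ring
      have hhalf : ((1 / 2 : ℝ) : ℂ) = (1 / 2 : ℂ) := by norm_num
      rw [hd, ← Complex.coe_smul (1 / 2 : ℝ), hhalf]
      simp only [Matrix.mul_sub, Matrix.sub_mul, Matrix.mul_add, Matrix.add_mul, Matrix.mul_smul,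
        Matrix.smul_mul]
      module)
  refine ⟨W * G, ?_, ?_⟩
  · rw [conjTranspose_mul, Matrix.mul_assoc, ← Matrix.mul_assoc G, hGG, Matrix.one_mul, hW]
  · rw [← hWc, conjTranspose_mul]
    simp only [Matrix.mul_assoc]

theorem posSemidef_conj_diagonal {U : Matrix ι ι ℂ} {a : ι → ℝ} (ha : ∀ i, 0 ≤ a i) :
    (U * diagonal (fun i => (a i : ℂ)) * Uᴴ).PosSemidef :=
  (posSemidef_diagonal_ofReal ha).mul_mul_conjTranspose_same U

/-- `exists_unitary_corner_of_injective` without the assumption that the spectra are simple, obtained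
by perturbation and compactness. -/
theorem exists_unitary_corner {p : ℕ} {U V Z : Matrix (Fin p) (Fin p) ℂ} {a b c : Fin p → ℝ}
    (hU : U * Uᴴ = 1) (hV : V * Vᴴ = 1) (hZ : Z * Zᴴ = 1) (ha : Antitone a) (hb : Antitone b)
    (hc : Antitone c) (hc0 : ∀ i, 0 ≤ c i) (hab : ∀ i j, b i ≤ a j)
    (h : (U * diagonal (fun i => (a i : ℂ)) * Uᴴ - V * diagonal (fun i => (b i : ℂ)) * Vᴴ -
      (Z * diagonal (fun i => (c i : ℂ)) * Zᴴ + Z * diagonal (fun i => (c i : ℂ)) * Zᴴ)).PosSemidef) :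
    ∃ W : Matrix (Fin p ⊕ Fin p) (Fin p ⊕ Fin p) ℂ, W * Wᴴ = 1 ∧
      (W * diagonal (fun i => ((Sum.elim a b i : ℝ) : ℂ)) * Wᴴ).toBlocks₁₂ =
        diagonal fun i => (c i : ℂ) := by
  let a' : ℝ → Fin p → ℝ := fun δ i => a i + δ * (2 * p - i)
  let b' : ℝ → Fin p → ℝ := fun δ i => b i - δ * i
  let c' : ℝ → Fin p → ℝ := fun δ i => c i + δ * ((p - i) / 2)
  have hip : ∀ i : Fin p, ((i : ℕ) : ℝ) < p := fun i => by exact_mod_cast i.2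
  have hi0 : ∀ i : Fin p, 0 ≤ ((i : ℕ) : ℝ) := fun i => by positivity
  have hlt : ∀ {i j : Fin p}, i < j → ((i : ℕ) : ℝ) < (j : ℕ) := fun {i j} hij => by
    exact_mod_cast hij
  have main : ∀ δ : ℝ, 0 < δ → ∃ W : Matrix (Fin p ⊕ Fin p) (Fin p ⊕ Fin p) ℂ, W * Wᴴ = 1 ∧
      (W * diagonal (fun i => ((Sum.elim (a' δ) (b' δ) i : ℝ) : ℂ)) * Wᴴ).toBlocks₁₂ =
        diagonal fun i => (c' δ i : ℂ) := by
    intro δ hδ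
    have ha' : StrictAnti (a' δ) := fun i j hij => by
      have := ha hij.le
      have := mul_lt_mul_of_pos_left (hlt hij) hδ
      simp only [a']
      nlinarith
    have hb' : StrictAnti (b' δ) := fun i j hij => by
      have := hb hij.le
      have := mul_lt_mul_of_pos_left (hlt hij) hδ
      simp only [b']
      nlinarith
    have hc' : StrictAnti (c' δ) := fun i j hij => by
      have := hc hij.le
      have := mul_lt_mul_of_pos_left (hlt hij) hδ
      simp only [c']
      nlinarith
    have hlt' : ∀ i j, b' δ i < a' δ j := fun i j => by
      have h1 := hab i j
      have h2 := mul_nonneg hδ.le (hi0 i)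
      have h3 := mul_pos hδ (by linarith [hip j, hi0 j] : (0 : ℝ) < 2 * p - j)
      simp only [a', b']
      linarith
    refine exists_unitary_corner_of_injective hU hV hZ
      (ha'.injective.sumElim hb'.injective fun i j => (hlt' j i).ne') hc'.injective
      (fun i => add_nonneg (hc0 i) (mul_nonneg hδ.le (by linarith [hip i]))) ?_
    have hone : ∀ {Y : Matrix (Fin p) (Fin p) ℂ}, Y * Yᴴ = 1 → ∀ r : ℝ,
        Y * diagonal (fun _ => (r : ℂ)) * Yᴴ = r • 1 := by
      intro Y hY r
      have : diagonal (fun _ : Fin p => (r : ℂ)) = r • 1 := by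
        ext i j; simp [diagonal_apply, one_apply]
      rw [this, Matrix.mul_smul, Matrix.smul_mul, Matrix.mul_one, hY]
    have p1 := posSemidef_conj_diagonal (U := U) (a := fun i => δ * (p - i))
      fun i => mul_nonneg hδ.le (by linarith [hip i])
    have p2 := posSemidef_conj_diagonal (U := V) (a := fun i => δ * i)
      fun i => mul_nonneg hδ.le (hi0 i)
    have p3 := posSemidef_conj_diagonal (U := Z) (a := fun i => δ * i)
      fun i => mul_nonneg hδ.le (hi0 i)
    have hadd : ∀ (f g : Fin p → ℂ), Z * diagonal f * Zᴴ + Z * diagonal g * Zᴴ =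
        Z * diagonal (fun i => f i + g i) * Zᴴ := fun f g => by
      rw [← Matrix.add_mul, ← Matrix.mul_add, diagonal_add]
    have hsub : ∀ (f g : Fin p → ℂ), Z * diagonal f * Zᴴ - Z * diagonal g * Zᴴ =
        Z * diagonal (fun i => f i - g i) * Zᴴ := fun f g => by
      rw [← Matrix.sub_mul, ← Matrix.mul_sub, diagonal_sub]
    have eU : U * diagonal (fun i => (a' δ i : ℂ)) * Uᴴ = U * diagonal (fun i => (a i : ℂ)) * Uᴴ +
        U * diagonal (fun i : Fin p => ((δ * (p - i) : ℝ) : ℂ)) * Uᴴ + (δ * p) • 1 := by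
      rw [← hone hU, ← Matrix.add_mul, ← Matrix.add_mul, ← Matrix.mul_add, ← Matrix.mul_add,
        diagonal_add, diagonal_add]
      congr 3; funext i; simp only [a']; push_cast; ring
    have eV : V * diagonal (fun i => (b' δ i : ℂ)) * Vᴴ = V * diagonal (fun i => (b i : ℂ)) * Vᴴ -
        V * diagonal (fun i : Fin p => ((δ * i : ℝ) : ℂ)) * Vᴴ := by
      rw [← Matrix.sub_mul, ← Matrix.mul_sub, diagonal_sub]
      congr 3; funext i; simp only [b']; push_cast; ring
    have eZ : Z * diagonal (fun i => (c' δ i : ℂ)) * Zᴴ + Z * diagonal (fun i => (c' δ i : ℂ)) * Zᴴ =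
        (Z * diagonal (fun i => (c i : ℂ)) * Zᴴ + Z * diagonal (fun i => (c i : ℂ)) * Zᴴ) -
        Z * diagonal (fun i : Fin p => ((δ * i : ℝ) : ℂ)) * Zᴴ + (δ * p) • 1 := by
      rw [← hone hZ]
      simp only [hadd, hsub]
      congr 3; funext i; simp only [c']; push_cast; ring
    rw [eU, eV, eZ]
    convert ((h.add p1).add p2).add p3 using 1
    abel
  have hb : Continuous fun X : Matrix (Fin p ⊕ Fin p) (Fin p ⊕ Fin p) ℂ => X.toBlocks₁₂ :=
    continuous_pi fun i => continuous_pi fun j => continuous_apply_apply (Sum.inl i) (Sum.inr j)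
  have hcomp := ((isCompact_Icc (a := (0 : ℝ)) (b := 1)).prod
    (isCompact_setOf_mul_conjTranspose_eq_one (κ := Fin p ⊕ Fin p)))
  have hclosed : IsClosed {x : ℝ × Matrix (Fin p ⊕ Fin p) (Fin p ⊕ Fin p) ℂ |
      (x.2 * diagonal (fun i => ((Sum.elim (a' x.1) (b' x.1) i : ℝ) : ℂ)) * x.2ᴴ).toBlocks₁₂ =
        diagonal fun i => (c' x.1 i : ℂ)} := by
    have h1 : Continuous fun x : ℝ × Matrix (Fin p ⊕ Fin p) (Fin p ⊕ Fin p) ℂ =>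
        diagonal (fun i => ((Sum.elim (a' x.1) (b' x.1) i : ℝ) : ℂ)) := by
      refine Continuous.matrix_diagonal (continuous_pi fun i => ?_)
      cases i <;> simp only [Sum.elim_inl, Sum.elim_inr, a', b'] <;> fun_prop
    have h2 : Continuous fun x : ℝ × Matrix (Fin p ⊕ Fin p) (Fin p ⊕ Fin p) ℂ =>
        diagonal fun i => (c' x.1 i : ℂ) := by
      refine Continuous.matrix_diagonal (continuous_pi fun i => ?_)
      simp only [c']
      fun_prop
    exact isClosed_eq (hb.comp (by fun_prop)) h2
  have hmem := ((hcomp.inter_right hclosed).image continuous_fst).isClosed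
  have h0 : (0 : ℝ) ∈ closure (Set.Ioc (0 : ℝ) 1) := by
    rw [closure_Ioc zero_ne_one]; exact ⟨le_rfl, zero_le_one⟩
  obtain ⟨⟨δ, W⟩, ⟨⟨-, hW⟩, hWc⟩, rfl⟩ := closure_minimal (fun δ hδ => by
    obtain ⟨W, hW, hWc⟩ := main δ hδ.1
    exact ⟨(δ, W), ⟨⟨⟨hδ.1.le, hδ.2⟩, hW⟩, hWc⟩, rfl⟩) hmem h0
  refine ⟨W, hW, ?_⟩
  have hWc' : (W * diagonal (fun i => ((Sum.elim (a' 0) (b' 0) i : ℝ) : ℂ)) * Wᴴ).toBlocks₁₂ =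
        diagonal fun i => (c' 0 i : ℂ) := hWc
  simpa [a', b', c'] using hWc'

theorem HasEigs.of_submatrix {M : Matrix κ κ ℂ} {μ : κ → ℝ} (e : ι ≃ κ)
    (h : HasEigs (M.submatrix e e) (μ ∘ e)) : HasEigs M μ := by
  obtain ⟨U, h1, h2, h3⟩ := h
  refine ⟨U.submatrix e.symm e.symm, ?_, ?_, ?_⟩
  · rw [conjTranspose_submatrix, submatrix_mul_equiv, h1, submatrix_one_equiv]
  · rw [conjTranspose_submatrix, submatrix_mul_equiv, h2, submatrix_one_equiv]
  · have hd : diagonal (fun i => (μ i : ℂ)) =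
        (diagonal fun i => (((μ ∘ e) i : ℝ) : ℂ)).submatrix e.symm e.symm := by
      rw [submatrix_diagonal_equiv]
      congr 1
      funext i
      simp
    rw [hd, conjTranspose_submatrix, submatrix_mul_equiv, submatrix_mul_equiv, ← h3]
    simp

/-- Hermitian matrices `C + C ≤ A - B` with the prescribed spectra yield a Hermitian block matrix whose
off-diagonal block has the prescribed singular values. -/
theorem exists_hasSVals_of_bounds (p n : ℕ) (hpn : 2 * p ≤ n) (lam s : ℕ → ℝ)
    (hlmono : ∀ a b, 1 ≤ a → a ≤ b → b ≤ n → lam b ≤ lam a)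
    (hsmono : ∀ a b, 1 ≤ a → a ≤ b → b ≤ p → s b ≤ s a)
    (hsnn : ∀ a, 1 ≤ a → a ≤ p → 0 ≤ s a)
    (A B C : Matrix (Fin p) (Fin p) ℂ)
    (hA : HasEigs A (fun i => lam ((i : ℕ) + 1)))
    (hB : HasEigs B (fun i => lam (n - p + (i : ℕ) + 1)))
    (hC : HasEigs C (fun i => s ((i : ℕ) + 1)))
    (h : (A - B - (C + C)).PosSemidef) :
    ∃ (P : Matrix (Fin p) (Fin p) ℂ) (X : Matrix (Fin p) (Fin (n - p)) ℂ)
        (Q : Matrix (Fin (n - p)) (Fin (n - p)) ℂ),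
        HasEigs (fromBlocks P X Xᴴ Q) (fun i => lam ((finSumFinEquiv i : ℕ) + 1)) ∧
        HasSVals X p s := by
  obtain ⟨U, hU, -, rfl⟩ := hA
  obtain ⟨V, hV, -, rfl⟩ := hB
  obtain ⟨Z, hZ, -, rfl⟩ := hC
  set a : Fin p → ℝ := fun i => lam ((i : ℕ) + 1) with ha
  set b : Fin p → ℝ := fun i => lam (n - p + (i : ℕ) + 1) with hb
  set c : Fin p → ℝ := fun i => s ((i : ℕ) + 1) with hc
  obtain ⟨W, hW, hWc⟩ := exists_unitary_corner (a := a) (b := b) (c := c) hU hV hZ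
    (fun i j hij => hlmono _ _ (by omega) (by simpa using hij) (by omega))
    (fun i j hij => hlmono _ _ (by omega) (by simpa using hij) (by omega))
    (fun i j hij => hsmono _ _ (by omega) (by simpa using hij) (by omega))
    (fun i => hsnn _ (by omega) (by omega))
    (fun i j => hlmono _ _ (by omega) (by omega) (by omega)) h
  have hW' : Wᴴ * W = 1 := mul_eq_one_comm.1 hW
  set N := W * diagonal (fun i => ((Sum.elim a b i : ℝ) : ℂ)) * Wᴴ with hN
  have hNH : N.IsHermitian :=
    isHermitian_mul_mul_conjTranspose W (isHermitian_diagonal_ofReal (Sum.elim a b))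
  have hN12 : ∀ i j, N (Sum.inl i) (Sum.inr j) = diagonal (fun i => (c i : ℂ)) i j := fun i j =>
    congrFun (congrFun hWc i) j
  let f : Fin (n - 2 * p) ⊕ Fin p ≃ Fin (n - p) :=
    finSumFinEquiv.trans (finCongr (by omega))
  let X' : Matrix (Fin p) (Fin (n - 2 * p) ⊕ Fin p) ℂ :=
    fromCols 0 (diagonal fun i => (c i : ℂ))
  let mid : Fin (n - 2 * p) → ℝ := fun j => lam (p + (j : ℕ) + 1)
  let Q' : Matrix (Fin (n - 2 * p) ⊕ Fin p) (Fin (n - 2 * p) ⊕ Fin p) ℂ :=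
    fromBlocks (diagonal fun j => (mid j : ℂ)) 0 0 N.toBlocks₂₂
  refine ⟨N.toBlocks₁₁, X'.submatrix id f.symm, Q'.submatrix f.symm f.symm, ?_, ?_⟩
  · let g : (Fin p ⊕ Fin p) ⊕ Fin (n - 2 * p) ≃ Fin p ⊕ Fin (n - p) :=
      (Equiv.sumAssoc _ _ _).trans (Equiv.sumCongr (Equiv.refl _) ((Equiv.sumComm _ _).trans f))
    refine HasEigs.of_submatrix g ?_
    have hblocks : (fromBlocks N.toBlocks₁₁ (X'.submatrix id f.symm) (X'.submatrix id f.symm)ᴴ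
        (Q'.submatrix f.symm f.symm)).submatrix g g =
        fromBlocks N 0 0 (diagonal fun j => (mid j : ℂ)) := by
      ext k l
      rcases k with (k | k) | k <;> rcases l with (l | l) | l
      · simp [g, toBlocks₁₁]
      · simp [g, X', hN12]
      · simp [g, X']
      · rw [fromBlocks_apply₁₁, ← hNH.apply, hN12]
        simp [g, X']
      · simp [g, Q', toBlocks₂₂]
      · simp [g, Q']
      · simp [g, X']
      · simp [g, Q']
      · simp [g, Q']
    rw [hblocks]
    refine ⟨fromBlocks W 0 0 1, ?_, ?_, ?_⟩
    · rw [fromBlocks_conjTranspose, fromBlocks_multiply]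
      simp [hW]
    · rw [fromBlocks_conjTranspose, fromBlocks_multiply]
      simp [hW']
    · have hd : diagonal (fun i => ((((fun i => lam ((finSumFinEquiv i : ℕ) + 1)) ∘ g) i : ℝ) : ℂ))
          = fromBlocks (diagonal (fun i => ((Sum.elim a b i : ℝ) : ℂ))) 0 0
            (diagonal fun j => (mid j : ℂ)) := by
        rw [fromBlocks_diagonal]
        congr 1
        funext k
        rcases k with (k | k) | k
        · simp [g, a]
        · have : p + (n - 2 * p + (k : ℕ)) + 1 = n - p + k + 1 := by omega
          simp [g, f, b, this]
        · simp [g, f, mid]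
      rw [hd, fromBlocks_conjTranspose, fromBlocks_multiply, fromBlocks_multiply]
      simp [hN]
  · refine ⟨by simp; omega, hsmono, hsnn, ?_⟩
    let e : Fin (n - p) ≃ Fin (Fintype.card (Fin (n - p))) :=
      f.symm.trans ((Equiv.sumComm _ _).trans
        (finSumFinEquiv.trans (finCongr (by simp; omega))))
    refine ⟨e, 1, by simp, by simp, ?_⟩
    rw [conjTranspose_one, Matrix.one_mul, Matrix.mul_one]
    ext k l
    obtain ⟨k, rfl⟩ := f.surjective k
    obtain ⟨l, rfl⟩ := f.surjective l
    have hef : ∀ i, (e (f i) : ℕ) = Sum.elim (fun k : Fin (n - 2 * p) => p + (k : ℕ))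
        (fun k : Fin p => (k : ℕ)) i := by
      rintro (k | k) <;> simp [e]
    have hXX : X'ᴴ * X' = fromBlocks 0 0 0 (diagonal fun i => ((c i ^ 2 : ℝ) : ℂ)) := by
      rw [show X' = fromCols 0 (diagonal fun i => (c i : ℂ)) from rfl,
        conjTranspose_fromCols_eq_fromRows_conjTranspose, fromRows_mul_fromCols]
      simp [diagonal_conjTranspose, diagonal_mul_diagonal, sq, Pi.star_def]
    have hkl : ((X'.submatrix id f.symm)ᴴ * X'.submatrix id f.symm) (f k) (f l) =
        (X'ᴴ * X') k l := by
      simp [mul_apply]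
    rw [hkl, hXX, diagonal_apply]
    beta_reduce
    rw [hef]
    rcases k with k | k <;> rcases l with l | l
    · simp [Nat.add_assoc]
    · simp
    · simp
    · have hk : (k : ℕ) + 1 ≤ p := k.2
      simp [diagonal_apply, hk, c]

end Matrix

theorem stmt6 (p n : ℕ) (hp : 0 < p) (hpn : 2 * p ≤ n) (lam s : ℕ → ℝ)
    (hlmono : ∀ a b, 1 ≤ a → a ≤ b → b ≤ n → lam b ≤ lam a)
    (hsmono : ∀ a b, 1 ≤ a → a ≤ b → b ≤ p → s b ≤ s a)
    (hsnn : ∀ a, 1 ≤ a → a ≤ p → 0 ≤ s a) :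
    (∃ (P : Matrix (Fin p) (Fin p) ℂ) (X : Matrix (Fin p) (Fin (n - p)) ℂ)
        (Q : Matrix (Fin (n - p)) (Fin (n - p)) ℂ),
        HasEigs (Matrix.fromBlocks P X X.conjTranspose Q)
          (fun i => lam ((finSumFinEquiv i : ℕ) + 1)) ∧
        HasSVals X p s) ↔
    (∃ A B C : Matrix (Fin p) (Fin p) ℂ,
        HasEigs A (fun i => lam ((i : ℕ) + 1)) ∧
        HasEigs B (fun i => lam (n - p + (i : ℕ) + 1)) ∧
        HasEigs C (fun i => s ((i : ℕ) + 1)) ∧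
        (A - B - (C + C)).PosSemidef) := by
  constructor
  · rintro ⟨P, X, Q, hM, hX⟩
    exact Matrix.exists_bounds_of_hasSVals p n hpn lam s hlmono P X Q hM hX
  · rintro ⟨A, B, C, hA, hB, hC, h⟩
    exact Matrix.exists_hasSVals_of_bounds p n hpn lam s hlmono hsmono hsnn A B C hA hB hC h
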